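/- Let n ≥ 5 and n/(n-4) < p < (n+4)/(n-4), and let u be a nonnegative C⁴ solution of Δ²u = u^p in the punctured ball B₁\{0} ⊂ ℝⁿ. If ∫_{{0<|x|≤1/2}} u(x)^{(p-1)n/4} dx < +∞, then the singularity at x = 0 is removable: there exists a C⁴ function ũ on B₁ with Δ²ũ = ũ^p in B₁ and ũ = u on B₁\{0}. -/

import Mathlib

open MeasureTheory Metric Filter

/-- The Euclidean Laplacian `Δu` of `u : ℝⁿ → ℝ`, computed as the trace of the second
derivative: `Δu(x) = ∑ i, ∂²u/∂xᵢ²(x)`. -/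
noncomputable def lap {n : ℕ} (u : EuclideanSpace ℝ (Fin n) → ℝ) :
    EuclideanSpace ℝ (Fin n) → ℝ :=
  fun x => ∑ i : Fin n,
    iteratedFDeriv ℝ 2 u x ![EuclideanSpace.single i 1, EuclideanSpace.single i 1]

/-- The biharmonic operator `Δ²u = Δ(Δu)`. -/
noncomputable def bilap {n : ℕ} (u : EuclideanSpace ℝ (Fin n) → ℝ) :
    EuclideanSpace ℝ (Fin n) → ℝ :=
  lap (lap u)

open scoped Topology ContDiff Convolution Pointwise

section Laplacian

variable {n : ℕ} {f g : EuclideanSpace ℝ (Fin n) → ℝ} {x : EuclideanSpace ℝ (Fin n)}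

lemma lap_eq_sum_fderiv (f : EuclideanSpace ℝ (Fin n) → ℝ) (x : EuclideanSpace ℝ (Fin n)) :
    lap f x = ∑ i : Fin n,
      fderiv ℝ (fderiv ℝ f) x (EuclideanSpace.single i 1) (EuclideanSpace.single i 1) := by
  simp [lap, iteratedFDeriv_two_apply]

lemma lap_congr (h : f =ᶠ[𝓝 x] g) : lap f =ᶠ[𝓝 x] lap g := by
  filter_upwards [h.iteratedFDeriv ℝ 2] with y hy
  simp [lap, hy]

lemma bilap_congr (h : f =ᶠ[𝓝 x] g) : bilap f =ᶠ[𝓝 x] bilap g :=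
  lap_congr (lap_congr h)

lemma contDiffAt_lap {k m : ℕ∞ω} (hf : ContDiffAt ℝ m f x) (hkm : k + 2 ≤ m) :
    ContDiffAt ℝ k (lap f) x := by
  have h : ContDiffAt ℝ k (iteratedFDeriv ℝ 2 f) x := hf.iteratedFDeriv_right hkm
  unfold lap
  refine ContDiffAt.sum fun i _ => ?_
  exact (ContinuousMultilinearMap.apply ℝ (fun _ : Fin 2 => EuclideanSpace ℝ (Fin n)) ℝ
    ![EuclideanSpace.single i 1, EuclideanSpace.single i 1]).contDiff.contDiffAt.comp x h

lemma contDiffAt_bilap {k m : ℕ∞ω} (hf : ContDiffAt ℝ m f x) (hkm : k + 4 ≤ m) :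
    ContDiffAt ℝ k (bilap f) x := by
  refine contDiffAt_lap (m := k + 2) (contDiffAt_lap hf ?_) le_rfl
  rwa [add_assoc, show (2 + 2 : ℕ∞ω) = 4 by norm_num]

lemma lap_add (hf : ContDiffAt ℝ 2 f x) (hg : ContDiffAt ℝ 2 g x) :
    lap (fun y => f y + g y) x = lap f x + lap g x := by
  simp only [lap, ← Finset.sum_add_distrib]
  refine Finset.sum_congr rfl fun i _ => ?_
  rw [show (fun y => f y + g y) = f + g from rfl, iteratedFDeriv_add_apply hf hg]
  rfl

lemma lap_const_mul (c : ℝ) (hf : ContDiffAt ℝ 2 f x) :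
    lap (fun y => c * f y) x = c * lap f x := by
  simp only [lap, Finset.mul_sum]
  refine Finset.sum_congr rfl fun i _ => ?_
  have := iteratedFDeriv_const_smul_apply' (a := c) hf
  simp only [smul_eq_mul] at this
  rw [this]
  rfl

lemma bilap_add (hf : ContDiffAt ℝ 4 f x) (hg : ContDiffAt ℝ 4 g x) :
    bilap (fun y => f y + g y) x = bilap f x + bilap g x := by
  have h24 : (2 : ℕ∞ω) ≤ 4 := by norm_num
  have h : lap (fun y => f y + g y) =ᶠ[𝓝 x] fun y => lap f y + lap g y := by
    filter_upwards [hf.eventually (by simp), hg.eventually (by simp)] with y h1 h2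
    exact lap_add (h1.of_le h24) (h2.of_le h24)
  unfold bilap
  rw [(lap_congr h).eq_of_nhds]
  exact lap_add (contDiffAt_lap hf (by norm_num)) (contDiffAt_lap hg (by norm_num))

lemma bilap_const_mul (c : ℝ) (hf : ContDiffAt ℝ 4 f x) :
    bilap (fun y => c * f y) x = c * bilap f x := by
  have h24 : (2 : ℕ∞ω) ≤ 4 := by norm_num
  have h : lap (fun y => c * f y) =ᶠ[𝓝 x] fun y => c * lap f y := by
    filter_upwards [hf.eventually (by simp)] with y h1
    exact lap_const_mul c (h1.of_le h24)
  unfold bilap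
  rw [(lap_congr h).eq_of_nhds]
  exact lap_const_mul c (contDiffAt_lap hf (by norm_num))

lemma bilap_sub (hf : ContDiffAt ℝ 4 f x) (hg : ContDiffAt ℝ 4 g x) :
    bilap (fun y => f y - g y) x = bilap f x - bilap g x := by
  have h := bilap_add hf (contDiffAt_const.mul hg : ContDiffAt ℝ 4 (fun y => (-1 : ℝ) * g y) x)
  rw [bilap_const_mul _ hg] at h
  simpa [sub_eq_add_neg] using h

lemma lap_comp_smul (a : ℝ) (hf : ContDiff ℝ 2 f) :
    lap (fun y => f (a • y)) = fun y => a ^ 2 * lap f (a • y) := by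
  ext y
  simp [lap, iteratedFDeriv_comp_const_smul a hf, Finset.mul_sum]

lemma bilap_comp_smul (a : ℝ) (hf : ContDiff ℝ 4 f) :
    bilap (fun y => f (a • y)) = fun y => a ^ 4 * bilap f (a • y) := by
  have h2 : ContDiff ℝ 2 (lap f) :=
    contDiff_iff_contDiffAt.2 fun y => contDiffAt_lap hf.contDiffAt (by norm_num)
  unfold bilap
  rw [lap_comp_smul a (hf.of_le (by norm_num))]
  ext y
  rw [lap_const_mul (f := fun z => lap f (a • z)) _ (h2.comp (contDiff_const_smul a)).contDiffAt,
    lap_comp_smul a h2]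
  ring

lemma lap_comp_add (a : EuclideanSpace ℝ (Fin n)) :
    lap (fun y => f (y + a)) = fun y => lap f (y + a) := by
  ext y
  simp [lap, iteratedFDeriv_comp_add_right]

lemma bilap_comp_add (a : EuclideanSpace ℝ (Fin n)) :
    bilap (fun y => f (y + a)) = fun y => bilap f (y + a) := by
  unfold bilap
  rw [lap_comp_add, lap_comp_add]

lemma bilap_comp_sub_left (a : EuclideanSpace ℝ (Fin n)) (hf : ContDiff ℝ 4 f) :
    bilap (fun y => f (a - y)) = fun y => bilap f (a - y) := by
  have h := bilap_comp_add (f := fun y => f ((-1 : ℝ) • y)) (-a)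
  rw [bilap_comp_smul _ hf] at h
  simpa [sub_eq_add_neg, add_comm, Even.neg_pow (show Even 4 by decide)] using h

lemma tsupport_lap_subset : tsupport (lap f) ⊆ tsupport f := by
  intro y hy
  by_contra h
  have h0 : f =ᶠ[𝓝 y] fun _ => 0 := notMem_tsupport_iff_eventuallyEq.1 h
  refine notMem_tsupport_iff_eventuallyEq.2 ?_ hy
  refine (lap_congr h0).trans (Eventually.of_forall fun z => ?_)
  simp [lap_eq_sum_fderiv]

lemma bilap_eq_zero_of_eventuallyEq_zero (h : f =ᶠ[𝓝 x] fun _ => 0) : bilap f x = 0 := by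
  have h1 : x ∉ tsupport f := notMem_tsupport_iff_eventuallyEq.2 h
  exact image_eq_zero_of_notMem_tsupport
    fun h2 => h1 (tsupport_lap_subset (tsupport_lap_subset h2))

lemma integrable_mul_of_tsupport (hf : ∀ y ∈ tsupport g, ContinuousAt f y) (hg : Continuous g)
    (hgc : HasCompactSupport g) : Integrable fun y => f y * g y := by
  refine Continuous.integrable_of_hasCompactSupport ?_ hgc.mul_left
  refine continuous_of_tsupport fun y hy => ?_
  exact (hf y (tsupport_mul_subset_right hy)).mul hg.continuousAt

lemma integral_mul_lap (hf : ∀ y ∈ tsupport g, ContDiffAt ℝ 2 f y) (hg : ContDiff ℝ 2 g)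
    (hgc : HasCompactSupport g) : ∫ y, f y * lap g y = ∫ y, lap f y * g y := by
  have key (i : Fin n) : Integrable (fun y => f y * fderiv ℝ (fderiv ℝ g) y
        (EuclideanSpace.single i 1) (EuclideanSpace.single i 1)) ∧
      Integrable (fun y => fderiv ℝ (fderiv ℝ f) y
        (EuclideanSpace.single i 1) (EuclideanSpace.single i 1) * g y) ∧
      ∫ y, f y * fderiv ℝ (fderiv ℝ g) y
        (EuclideanSpace.single i 1) (EuclideanSpace.single i 1) =
      ∫ y, fderiv ℝ (fderiv ℝ f) y
        (EuclideanSpace.single i 1) (EuclideanSpace.single i 1) * g y := by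
    set e : EuclideanSpace ℝ (Fin n) := EuclideanSpace.single i 1
    have hg1 : ContDiff ℝ 1 (fderiv ℝ g) := hg.fderiv_right (by norm_num)
    have hg1e : ContDiff ℝ 1 (fun y => fderiv ℝ g y e) := hg1.clm_apply contDiff_const
    have hgs : tsupport (fderiv ℝ g) ⊆ tsupport g := tsupport_fderiv_subset ℝ
    have hsub {h : EuclideanSpace ℝ (Fin n) → EuclideanSpace ℝ (Fin n) →L[ℝ] ℝ} :
        tsupport (fun y => h y e) ⊆ tsupport h := by
      refine closure_mono fun y hy => ?_
      contrapose! hy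
      simp [Function.notMem_support.1 hy]
    have hg1c : HasCompactSupport (fun y => fderiv ℝ g y e) :=
      (hgc.fderiv ℝ).of_isClosed_subset (isClosed_tsupport _) hsub
    have hd2 (h : EuclideanSpace ℝ (Fin n) → ℝ) (y) (hh : ContDiffAt ℝ 2 h y) :
        fderiv ℝ (fun z => fderiv ℝ h z e) y = (fderiv ℝ (fderiv ℝ h) y).flip e := by
      have : DifferentiableAt ℝ (fderiv ℝ h) y :=
        (hh.fderiv_right (m := 1) (by norm_num)).differentiableAt (by norm_num)
      ext v
      rw [fderiv_clm_apply this (differentiableAt_const e)]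
      simp
    have hf1 (y) (hy : y ∈ tsupport g) : ContDiffAt ℝ 1 (fun z => fderiv ℝ f z e) y :=
      ((hf y hy).fderiv_right (m := 1) (by norm_num)).clm_apply contDiffAt_const
    have hf2 (y) (hy : y ∈ tsupport g) : ContinuousAt (fun z => fderiv ℝ (fderiv ℝ f) z e e) y :=
      (((((hf y hy).fderiv_right (m := 1) (by norm_num)).fderiv_right (m := 0)
        (by norm_num)).clm_apply contDiffAt_const).clm_apply contDiffAt_const).continuousAt
    have hg2 : Continuous (fun z => fderiv ℝ (fderiv ℝ g) z e e) :=
      (((hg1.fderiv_right (m := 0) (by norm_num)).clm_apply contDiff_const).clm_apply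
        contDiff_const).continuous
    have hg2s : tsupport (fun z => fderiv ℝ (fderiv ℝ g) z e e) ⊆ tsupport g :=
      (hsub (h := fun z => fderiv ℝ (fderiv ℝ g) z e)).trans
        ((closure_mono fun y hy => by
          contrapose! hy
          simp [Function.notMem_support.1 hy]).trans
            ((tsupport_fderiv_subset ℝ (f := fderiv ℝ g)).trans hgs))
    have hg2c : HasCompactSupport (fun z => fderiv ℝ (fderiv ℝ g) z e e) :=
      hgc.of_isClosed_subset (isClosed_tsupport _) hg2s
    have i1 : Integrable (fun y => f y * fderiv ℝ (fderiv ℝ g) y e e) :=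
      integrable_mul_of_tsupport (fun y hy => (hf y (hg2s hy)).continuousAt) hg2 hg2c
    have i2 : Integrable (fun y => fderiv ℝ (fderiv ℝ f) y e e * g y) :=
      integrable_mul_of_tsupport hf2 hg.continuous hgc
    have i3 : Integrable (fun y => fderiv ℝ f y e * fderiv ℝ g y e) :=
      integrable_mul_of_tsupport (fun y hy => (hf1 y (hgs (hsub hy))).continuousAt)
        hg1e.continuous hg1c
    have i4 : Integrable (fun y => f y * fderiv ℝ g y e) :=
      integrable_mul_of_tsupport (fun y hy => (hf y (hgs (hsub hy))).continuousAt)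
        hg1e.continuous hg1c
    have i5 : Integrable (fun y => fderiv ℝ f y e * g y) :=
      integrable_mul_of_tsupport (fun y hy => (hf1 y hy).continuousAt) hg.continuous hgc
    refine ⟨i1, i2, ?_⟩
    have e1 : (fun y => f y * fderiv ℝ (fderiv ℝ g) y e e) =
        fun y => f y * fderiv ℝ (fun z => fderiv ℝ g z e) y e := by
      ext y; rw [hd2 g y hg.contDiffAt]; rfl
    have e2 : (fun y => fderiv ℝ (fderiv ℝ f) y e e * g y) =
        fun y => fderiv ℝ (fun z => fderiv ℝ f z e) y e * g y := by
      ext y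
      by_cases hy : y ∈ tsupport g
      · rw [hd2 f y (hf y hy)]; rfl
      · simp [image_eq_zero_of_notMem_tsupport hy]
    rw [e1, e2]
    rw [e1] at i1
    rw [e2] at i2
    have p1 := integral_mul_fderiv_eq_neg_fderiv_mul_of_integrable (v := e) i3 i1 i4
      (fun y hy => (hf y (hgs (hsub hy))).differentiableAt (by norm_num))
      (fun y _ => hg1e.differentiable (by norm_num) y)
    have p2 := integral_mul_fderiv_eq_neg_fderiv_mul_of_integrable (v := e) i2 i3 i5
      (fun y hy => (hf1 y hy).differentiableAt (by norm_num))
      (fun y _ => hg.differentiable (by norm_num) y)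
    rw [p1, p2, neg_neg]
  simp only [lap_eq_sum_fderiv, Finset.mul_sum, Finset.sum_mul]
  rw [integral_finsetSum _ fun i _ => (key i).1, integral_finsetSum _ fun i _ => (key i).2.1]
  exact Finset.sum_congr rfl fun i _ => (key i).2.2

lemma integral_mul_bilap (hf : ∀ y ∈ tsupport g, ContDiffAt ℝ 4 f y) (hg : ContDiff ℝ 4 g)
    (hgc : HasCompactSupport g) : ∫ y, f y * bilap g y = ∫ y, bilap f y * g y := by
  have hg2 : ContDiff ℝ 2 (lap g) :=
    contDiff_iff_contDiffAt.2 fun y => contDiffAt_lap hg.contDiffAt (by norm_num)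
  unfold bilap
  rw [integral_mul_lap (fun y hy => (hf y (tsupport_lap_subset hy)).of_le (by norm_num)) hg2
    (hgc.of_isClosed_subset (isClosed_tsupport _) tsupport_lap_subset)]
  exact integral_mul_lap (fun y hy => contDiffAt_lap (hf y hy) (by norm_num))
    (hg.of_le (by norm_num)) hgc

end Laplacian

section Kernel

variable {n : ℕ} {x : EuclideanSpace ℝ (Fin n)}

lemma contDiffAt_normSq_add_rpow {e s : ℝ} (hx : 0 < ‖x‖ ^ 2 + e) {m : ℕ∞ω} :
    ContDiffAt ℝ m (fun y : EuclideanSpace ℝ (Fin n) => (‖y‖ ^ 2 + e) ^ s) x :=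
  ((contDiff_norm_sq ℝ).contDiffAt.add contDiffAt_const).rpow_const_of_ne hx.ne'

lemma hasFDerivAt_normSq_add_rpow {e s : ℝ} (hx : 0 < ‖x‖ ^ 2 + e) :
    HasFDerivAt (fun y : EuclideanSpace ℝ (Fin n) => (‖y‖ ^ 2 + e) ^ s)
      ((2 * s * (‖x‖ ^ 2 + e) ^ (s - 1)) • innerSL ℝ x) x := by
  have h := (((hasStrictFDerivAt_norm_sq x).hasFDerivAt.add_const e).rpow_const (p := s)
    (Or.inl hx.ne'))
  have heq : (2 * s * (‖x‖ ^ 2 + e) ^ (s - 1)) • innerSL ℝ x =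
      (s * (‖x‖ ^ 2 + e) ^ (s - 1)) • (2 • innerSL ℝ x) := by
    module
  rw [heq]
  exact h

lemma lap_normSq_add_rpow {e : ℝ} (s : ℝ) (hx : 0 < ‖x‖ ^ 2 + e) :
    lap (fun y : EuclideanSpace ℝ (Fin n) => (‖y‖ ^ 2 + e) ^ s) x =
      2 * s * (n + 2 * s - 2) * (‖x‖ ^ 2 + e) ^ (s - 1) -
        4 * s * (s - 1) * e * (‖x‖ ^ 2 + e) ^ (s - 2) := by
  have hnear : ∀ᶠ y in 𝓝 x, 0 < ‖y‖ ^ 2 + e :=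
    (by fun_prop : Continuous fun y : EuclideanSpace ℝ (Fin n) => ‖y‖ ^ 2 + e).continuousAt.eventually
      (lt_mem_nhds hx)
  have hterm (i : Fin n) : fderiv ℝ (fderiv ℝ
      (fun y : EuclideanSpace ℝ (Fin n) => (‖y‖ ^ 2 + e) ^ s)) x (EuclideanSpace.single i 1)
        (EuclideanSpace.single i 1) = 4 * s * (s - 1) * (‖x‖ ^ 2 + e) ^ (s - 2) * x i ^ 2 +
          2 * s * (‖x‖ ^ 2 + e) ^ (s - 1) := by
    have h1 : fderiv ℝ (fun y : EuclideanSpace ℝ (Fin n) => (‖y‖ ^ 2 + e) ^ s) =ᶠ[𝓝 x]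
        fun y => (2 * s * (‖y‖ ^ 2 + e) ^ (s - 1)) • innerSL ℝ y := by
      filter_upwards [hnear] with y hy
      exact (hasFDerivAt_normSq_add_rpow hy).fderiv
    have h2 : HasFDerivAt (fun y : EuclideanSpace ℝ (Fin n) =>
        (2 * s * (‖y‖ ^ 2 + e) ^ (s - 1)) • innerSL ℝ y) _ x :=
      ((hasFDerivAt_normSq_add_rpow (s := s - 1) hx).const_mul (2 * s)).smul
        (innerSL ℝ).hasFDerivAt
    rw [h1.fderiv_eq, h2.fderiv]
    simp only [add_apply, smul_apply, ContinuousLinearMap.smulRight_apply, innerSL_apply_apply,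
      EuclideanSpace.inner_single_right, smul_eq_mul]
    have hee : innerSL ℝ (EuclideanSpace.single i (1 : ℝ)) (EuclideanSpace.single i (1 : ℝ)) =
        (1 : ℝ) := by
      rw [innerSL_apply_apply]
      simp
    rw [show s - 1 - 1 = s - 2 by ring]
    simp
    linear_combination 2 * s * (‖x‖ ^ 2 + e) ^ (s - 1) * hee
  rw [lap_eq_sum_fderiv, Finset.sum_congr rfl fun i _ => hterm i, Finset.sum_add_distrib,
    ← Finset.mul_sum, ← EuclideanSpace.real_norm_sq_eq]
  have h3 : (‖x‖ ^ 2 + e) ^ (s - 1) = (‖x‖ ^ 2 + e) ^ (s - 2) * (‖x‖ ^ 2 + e) := by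
    rw [← Real.rpow_add_one hx.ne']
    ring_nf
  simp only [Finset.sum_const, Finset.card_univ, Fintype.card_fin, nsmul_eq_mul]
  rw [h3]
  ring

lemma bilap_normSq_add_rpow {e s : ℝ} (hs : s = (4 - n) / 2) (hx : 0 < ‖x‖ ^ 2 + e) :
    bilap (fun y : EuclideanSpace ℝ (Fin n) => (‖y‖ ^ 2 + e) ^ s) x =
      16 * s * (s - 1) * (s - 2) * (s - 3) * e ^ 2 * (‖x‖ ^ 2 + e) ^ (s - 4) := by
  have hnear : ∀ᶠ y in 𝓝 x, 0 < ‖y‖ ^ 2 + e :=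
    (by fun_prop : Continuous fun y : EuclideanSpace ℝ (Fin n) => ‖y‖ ^ 2 + e).continuousAt.eventually
      (lt_mem_nhds hx)
  have h1 : lap (fun y : EuclideanSpace ℝ (Fin n) => (‖y‖ ^ 2 + e) ^ s) =ᶠ[𝓝 x] fun y =>
      2 * s * (n + 2 * s - 2) * (‖y‖ ^ 2 + e) ^ (s - 1) +
        (- (4 * s * (s - 1) * e)) * (‖y‖ ^ 2 + e) ^ (s - 2) := by
    filter_upwards [hnear] with y hy
    rw [lap_normSq_add_rpow s hy]
    ring
  unfold bilap
  rw [(lap_congr h1).eq_of_nhds, lap_add (contDiffAt_const.mul (contDiffAt_normSq_add_rpow hx))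
    (contDiffAt_const.mul (contDiffAt_normSq_add_rpow hx)),
    lap_const_mul _ (contDiffAt_normSq_add_rpow hx),
    lap_const_mul _ (contDiffAt_normSq_add_rpow hx), lap_normSq_add_rpow _ hx,
    lap_normSq_add_rpow _ hx]
  have hn : (n : ℝ) = 4 - 2 * s := by rw [hs]; ring
  rw [hn, show s - 1 - 1 = s - 2 by ring, show s - 1 - 2 = s - 3 by ring,
    show s - 2 - 1 = s - 3 by ring, show s - 2 - 2 = s - 4 by ring]
  ring

/-- A smooth radial cutoff, equal to `1` on the ball of radius `1 / 4` and supported in the ball of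
radius `1 / 2`. -/
noncomputable def cutoff (n : ℕ) : ContDiffBump (0 : EuclideanSpace ℝ (Fin n)) :=
  ⟨1 / 4, 1 / 2, by norm_num, by norm_num⟩

/-- A fundamental solution of the biharmonic operator, up to a multiplicative constant. -/
noncomputable def fundSol (n : ℕ) (x : EuclideanSpace ℝ (Fin n)) : ℝ := ‖x‖ ^ (4 - n : ℝ)

/-- The parametrix `χ(x / ρ) |x| ^ (4 - n)` at scale `ρ`. -/
noncomputable def parametrix (n : ℕ) (ρ : ℝ) (x : EuclideanSpace ℝ (Fin n)) : ℝ :=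
  cutoff n (ρ⁻¹ • x) * fundSol n x

/-- The smooth part `(χ(x / ρ) - 1) |x| ^ (4 - n)` of the parametrix. -/
noncomputable def corrector (n : ℕ) (ρ : ℝ) (x : EuclideanSpace ℝ (Fin n)) : ℝ :=
  (cutoff n (ρ⁻¹ • x) - 1) * fundSol n x

/-- The smooth error kernel `Δ²` of the corrector at scale `1`. -/
noncomputable def errKer (n : ℕ) : EuclideanSpace ℝ (Fin n) → ℝ := bilap (corrector n 1)

lemma cutoff_eq_one (hx : ‖x‖ ≤ 1 / 4) : cutoff n x = 1 :=
  (cutoff n).one_of_mem_closedBall (by simpa [cutoff] using hx)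

lemma cutoff_eq_zero (hx : 1 / 2 ≤ ‖x‖) : cutoff n x = 0 :=
  (cutoff n).zero_of_le_dist (by simpa [cutoff] using hx)

lemma norm_inv_smul_eq {ρ : ℝ} (hρ : 0 < ρ) : ‖ρ⁻¹ • x‖ = ‖x‖ / ρ := by
  rw [norm_smul, Real.norm_of_nonneg (by positivity)]
  ring

lemma contDiffAt_fundSol (hx : x ≠ 0) {m : ℕ∞ω} : ContDiffAt ℝ m (fundSol n) x :=
  (contDiffAt_norm ℝ hx).rpow_const_of_ne (norm_ne_zero_iff.2 hx)

lemma bilap_fundSol (hx : x ≠ 0) : bilap (fundSol n) x = 0 := by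
  have h : fundSol n = fun y => (‖y‖ ^ 2 + 0) ^ ((4 - n : ℝ) / 2) := by
    ext y
    rw [add_zero, ← Real.rpow_natCast_mul (norm_nonneg y), fundSol]
    congr 1
    push_cast
    ring
  rw [h, bilap_normSq_add_rpow rfl (by have := norm_pos_iff.2 hx; positivity)]
  simp

lemma contDiff_corrector {ρ : ℝ} (hρ : 0 < ρ) : ContDiff ℝ ∞ (corrector n ρ) := by
  refine contDiff_iff_contDiffAt.2 fun y => ?_
  by_cases hy : y = 0
  · refine (contDiffAt_const (c := (0 : ℝ))).congr_of_eventuallyEq ?_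
    have : ball (0 : EuclideanSpace ℝ (Fin n)) (ρ / 4) ∈ 𝓝 y := by
      rw [hy]; exact ball_mem_nhds _ (by positivity)
    filter_upwards [this] with z hz
    rw [corrector, cutoff_eq_one, sub_self, zero_mul]
    rw [mem_ball_zero_iff] at hz
    rw [norm_inv_smul_eq hρ, div_le_iff₀ hρ]
    linarith
  · exact (((cutoff n).contDiff.comp (contDiff_const_smul _)).contDiffAt.sub
      contDiffAt_const).mul (contDiffAt_fundSol hy)

lemma corrector_eq {ρ : ℝ} (hρ : 0 < ρ) (x : EuclideanSpace ℝ (Fin n)) :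
    corrector n ρ x = ρ ^ (4 - n : ℝ) * corrector n 1 (ρ⁻¹ • x) := by
  have h : fundSol n (ρ⁻¹ • x) = (ρ ^ (4 - n : ℝ))⁻¹ * fundSol n x := by
    rw [fundSol, fundSol, norm_smul, Real.norm_of_nonneg (by positivity),
      Real.mul_rpow (by positivity) (norm_nonneg _), Real.inv_rpow hρ.le]
  have h0 : ρ ^ (4 - n : ℝ) ≠ 0 := (Real.rpow_pos_of_pos hρ _).ne'
  rw [corrector, corrector, h, inv_one, one_smul]
  field_simp

lemma bilap_corrector {ρ : ℝ} (hρ : 0 < ρ) (x : EuclideanSpace ℝ (Fin n)) :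
    bilap (corrector n ρ) x = (ρ⁻¹) ^ n * errKer n (ρ⁻¹ • x) := by
  have h4 : ContDiff ℝ 4 (corrector n 1) := (contDiff_corrector one_pos).of_le (by norm_cast)
  have h : corrector n ρ = fun y => ρ ^ (4 - n : ℝ) * corrector n 1 (ρ⁻¹ • y) :=
    funext (corrector_eq hρ)
  rw [h, bilap_const_mul (f := fun y => corrector n 1 (ρ⁻¹ • y)) _
    (h4.comp (contDiff_const_smul _)).contDiffAt, bilap_comp_smul _ h4, ← mul_assoc, errKer]
  congr 1
  rw [Real.rpow_sub hρ, Real.rpow_natCast]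
  have : ρ ^ (4 : ℝ) = ρ ^ 4 := by exact_mod_cast Real.rpow_natCast ρ 4
  rw [this, inv_pow, inv_pow]
  field_simp

lemma contDiff_errKer : ContDiff ℝ ∞ (errKer n) :=
  contDiff_iff_contDiffAt.2 fun _ =>
    contDiffAt_bilap (m := ∞) (contDiff_corrector one_pos).contDiffAt (by norm_cast)

lemma errKer_eq_zero_of_lt (hx : 1 / 2 < ‖x‖) : errKer n x = 0 := by
  have hx0 : x ≠ 0 := by rintro rfl; simp at hx; linarith
  have h : corrector n 1 =ᶠ[𝓝 x] fun y => (-1) * fundSol n y := by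
    filter_upwards [continuous_norm.continuousAt.eventually (lt_mem_nhds hx)] with y hy
    rw [corrector, cutoff_eq_zero (by simpa using hy.le)]
    ring
  rw [errKer, (bilap_congr h).eq_of_nhds, bilap_const_mul _ (contDiffAt_fundSol hx0),
    bilap_fundSol hx0, mul_zero]

lemma norm_le_of_errKer_ne_zero (hx : errKer n x ≠ 0) : ‖x‖ ≤ 1 / 2 := by
  contrapose! hx
  exact errKer_eq_zero_of_lt hx

lemma hasCompactSupport_errKer : HasCompactSupport (errKer n) :=
  HasCompactSupport.of_support_subset_isCompact (isCompact_closedBall 0 (1 / 2)) fun y hy => by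
    simpa using norm_le_of_errKer_ne_zero hy

lemma parametrix_nonneg (ρ : ℝ) (x : EuclideanSpace ℝ (Fin n)) : 0 ≤ parametrix n ρ x :=
  mul_nonneg (cutoff n).nonneg (Real.rpow_nonneg (norm_nonneg _) _)

lemma parametrix_le (ρ : ℝ) (x : EuclideanSpace ℝ (Fin n)) :
    parametrix n ρ x ≤ ‖x‖ ^ (4 - n : ℝ) :=
  mul_le_of_le_one_left (Real.rpow_nonneg (norm_nonneg _) _) (cutoff n).le_one

lemma parametrix_eq_zero {ρ : ℝ} (hρ : 0 < ρ) (hx : ρ / 2 ≤ ‖x‖) : parametrix n ρ x = 0 := by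
  rw [parametrix, cutoff_eq_zero, zero_mul]
  rw [norm_inv_smul_eq hρ, le_div_iff₀ hρ]
  linarith

lemma parametrix_eq_fundSol {ρ : ℝ} (hρ : 0 < ρ) (hx : ‖x‖ ≤ ρ / 4) :
    parametrix n ρ x = fundSol n x := by
  rw [parametrix, cutoff_eq_one, one_mul]
  rw [norm_inv_smul_eq hρ, div_le_iff₀ hρ]
  linarith

lemma parametrix_sub (ρ σ : ℝ) (x : EuclideanSpace ℝ (Fin n)) :
    parametrix n ρ x - parametrix n σ x = corrector n ρ x - corrector n σ x := by
  simp only [parametrix, corrector]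
  ring

lemma measurable_parametrix (ρ : ℝ) : Measurable (parametrix n ρ) := by
  have h := (cutoff n).continuous
  unfold parametrix fundSol
  exact (h.comp (continuous_const_smul _)).measurable.mul (measurable_norm.pow_const _)

lemma corrector_sub_eq_zero {ρ σ : ℝ} (hσ : 0 < σ) (hσρ : σ ≤ ρ) (hx : ρ / 2 ≤ ‖x‖) :
    corrector n ρ x - corrector n σ x = 0 := by
  rw [← parametrix_sub, parametrix_eq_zero (hσ.trans_le hσρ) hx,
    parametrix_eq_zero hσ (by linarith), sub_zero]

lemma tsupport_corrector_sub_subset {ρ σ : ℝ} (hσ : 0 < σ) (hσρ : σ ≤ ρ) :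
    tsupport (fun x => corrector n ρ x - corrector n σ x) ⊆ closedBall 0 (ρ / 2) := by
  refine closure_minimal (fun y hy => ?_) isClosed_closedBall
  rw [mem_closedBall_zero_iff]
  by_contra! h
  exact hy (corrector_sub_eq_zero hσ hσρ h.le)

lemma hasCompactSupport_corrector_sub {ρ σ : ℝ} (hσ : 0 < σ) (hσρ : σ ≤ ρ) :
    HasCompactSupport (fun x => corrector n ρ x - corrector n σ x) :=
  (isCompact_closedBall _ _).of_isClosed_subset (isClosed_tsupport _)
    (tsupport_corrector_sub_subset hσ hσρ)

lemma integral_scaled_mul {ρ : ℝ} (hρ : 0 < ρ) (k ψ : EuclideanSpace ℝ (Fin n) → ℝ) :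
    ∫ y, ψ y * ((ρ⁻¹) ^ n * k (ρ⁻¹ • y)) = ∫ z, ψ (ρ • z) * k z := by
  have h := Measure.integral_comp_smul (volume : Measure (EuclideanSpace ℝ (Fin n)))
    (fun z => ψ (ρ • z) * k z) ρ⁻¹
  simp only [smul_inv_smul₀ hρ.ne', finrank_euclideanSpace, Fintype.card_fin] at h
  have hpos : 0 < ((ρ⁻¹) ^ n)⁻¹ := by positivity
  rw [abs_of_pos hpos, smul_eq_mul] at h
  have h2 : ∫ y, ψ y * ((ρ⁻¹) ^ n * k (ρ⁻¹ • y)) = (ρ⁻¹) ^ n * ∫ y, ψ y * k (ρ⁻¹ • y) := by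
    rw [← integral_const_mul]
    congr 1 with y
    ring
  rw [h2, h, ← mul_assoc, mul_inv_cancel₀ (by positivity), one_mul]

lemma integral_errKer_neg (hn : 5 ≤ n) : ∫ z, errKer n z < 0 := by
  set s : ℝ := (4 - n) / 2 with hs
  have hn' : (5 : ℝ) ≤ n := by exact_mod_cast hn
  have hs0 : s < 0 := by rw [hs]; linarith
  set ψ : EuclideanSpace ℝ (Fin n) → ℝ := fun y => (‖y‖ ^ 2 + 1) ^ s with hψ
  have hpos (y : EuclideanSpace ℝ (Fin n)) : 0 < ‖y‖ ^ 2 + 1 := by positivity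
  have hψd : ContDiff ℝ ∞ ψ := contDiff_iff_contDiffAt.2 fun y => contDiffAt_normSq_add_rpow (hpos y)
  have hψ1 (y) : ‖ψ y‖ ≤ 1 := by
    rw [Real.norm_of_nonneg (Real.rpow_nonneg (hpos y).le _)]
    exact Real.rpow_le_one_of_one_le_of_nonpos (by nlinarith [sq_nonneg ‖y‖]) hs0.le
  have hb (y) : 0 < bilap ψ y := by
    rw [bilap_normSq_add_rpow hs (hpos y)]
    have : 0 < s * (s - 1) * ((s - 2) * (s - 3)) :=
      mul_pos (mul_pos_of_neg_of_neg hs0 (by linarith))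
        (mul_pos_of_neg_of_neg (by linarith) (by linarith))
    have h2 := Real.rpow_pos_of_pos (hpos y) (s - 4)
    have := mul_pos this h2
    nlinarith
  have hbc : Continuous (bilap ψ) := continuous_iff_continuousAt.2 fun y =>
    (contDiffAt_bilap (k := 0) (m := ∞) hψd.contDiffAt (by norm_cast)).continuousAt
  set G : ℝ → ℝ := fun ρ => ∫ z, ψ (ρ • z) * errKer n z with hG
  have hkc : Continuous (errKer n) := contDiff_errKer.continuous
  have hki : Integrable (errKer n) := hkc.integrable_of_hasCompactSupport hasCompactSupport_errKer
  have hGdiff {ρ σ : ℝ} (hσ : 0 < σ) (hσρ : σ ≤ ρ) :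
      G ρ - G σ = ∫ y, bilap ψ y * (corrector n ρ y - corrector n σ y) := by
    have hρ := hσ.trans_le hσρ
    have c1 : ContDiff ℝ 4 (corrector n ρ) := (contDiff_corrector hρ).of_le (by norm_cast)
    have c2 : ContDiff ℝ 4 (corrector n σ) := (contDiff_corrector hσ).of_le (by norm_cast)
    rw [← integral_mul_bilap (fun y _ => hψd.contDiffAt.of_le (by norm_cast)) (c1.sub c2)
      (hasCompactSupport_corrector_sub hσ hσρ)]
    rw [hG]
    simp only
    rw [← integral_scaled_mul hρ, ← integral_scaled_mul hσ, ← integral_sub]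
    · congr 1 with y
      rw [bilap_sub c1.contDiffAt c2.contDiffAt, bilap_corrector hρ, bilap_corrector hσ]
      ring
    all_goals
      refine (Continuous.integrable_of_hasCompactSupport
        ((continuous_const.mul (hkc.comp (continuous_const_smul _)))) ?_).bdd_mul
          hψd.continuous.aestronglyMeasurable (c := 1) (Eventually.of_forall hψ1)
      refine (hasCompactSupport_errKer.comp_homeomorph
        (Homeomorph.smulOfNeZero (_ : ℝ) (inv_ne_zero ?_))).mul_left
      positivity
  have hmono {ρ σ : ℝ} (hσ : 0 < σ) (hσρ : 2 * σ ≤ ρ) : G σ ≤ G ρ := by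
    rw [← sub_nonneg, hGdiff hσ (by linarith)]
    refine integral_nonneg fun y => mul_nonneg (hb y).le ?_
    rw [← parametrix_sub, sub_nonneg]
    rcases le_total (σ / 2) ‖y‖ with h | h
    · rw [parametrix_eq_zero hσ h]
      exact parametrix_nonneg _ _
    · rw [parametrix_eq_fundSol (by linarith : 0 < ρ) (by linarith)]
      exact parametrix_le _ _
  have h41 : G 1 < G 4 := by
    rw [← sub_pos, hGdiff one_pos (by norm_num)]
    have c1 : ContDiff ℝ ∞ (corrector n 4) := contDiff_corrector (by norm_num)
    have c2 : ContDiff ℝ ∞ (corrector n 1) := contDiff_corrector (by norm_num)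
    have hge (y : EuclideanSpace ℝ (Fin n)) : 0 ≤ corrector n 4 y - corrector n 1 y := by
      rw [← parametrix_sub, sub_nonneg]
      rcases le_total (1 / 2) ‖y‖ with h | h
      · rw [parametrix_eq_zero one_pos h]
        exact parametrix_nonneg _ _
      · rw [parametrix_eq_fundSol (by norm_num : (0 : ℝ) < 4) (by linarith)]
        exact parametrix_le _ _
    refine Continuous.integral_pos_of_hasCompactSupport_nonneg_nonzero
      (x := EuclideanSpace.single (⟨0, by omega⟩ : Fin n) (3 / 4 : ℝ))
      (hbc.mul (c1.continuous.sub c2.continuous))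
      ((hasCompactSupport_corrector_sub one_pos (by norm_num)).mul_left)
      (fun y => mul_nonneg (hb y).le (hge y)) (mul_ne_zero (hb _).ne' ?_)
    rw [← parametrix_sub, parametrix_eq_zero one_pos (by simp; norm_num [abs_of_pos]),
      parametrix_eq_fundSol (by norm_num : (0 : ℝ) < 4) (by simp; norm_num [abs_of_pos]), sub_zero,
      fundSol]
    refine (Real.rpow_pos_of_pos ?_ _).ne'
    simp
  have hlim0 : Tendsto G (𝓝[>] 0) (𝓝 (∫ z, errKer n z)) := by
    have : ∫ z, errKer n z = ∫ z, ψ ((0 : ℝ) • z) * errKer n z := by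
      simp [hψ]
    rw [this]
    refine tendsto_integral_filter_of_dominated_convergence (fun z => ‖errKer n z‖)
      (Eventually.of_forall fun ρ => ?_) (Eventually.of_forall fun ρ => Eventually.of_forall
        fun z => ?_) hki.norm (Eventually.of_forall fun z => ?_)
    · exact ((hψd.continuous.comp (continuous_const_smul _)).mul hkc).aestronglyMeasurable
    · rw [norm_mul]
      exact mul_le_of_le_one_left (norm_nonneg _) (hψ1 _)
    · have hc : Continuous fun ρ : ℝ => ψ (ρ • z) * errKer n z :=
        (hψd.continuous.comp (continuous_id.smul continuous_const)).mul continuous_const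
      exact hc.continuousAt.tendsto.mono_left nhdsWithin_le_nhds
  have hliminf : Tendsto G atTop (𝓝 0) := by
    have h0 : (0 : ℝ) = ∫ _ : EuclideanSpace ℝ (Fin n), (0 : ℝ) := by simp
    rw [h0]
    refine tendsto_integral_filter_of_dominated_convergence (fun z => ‖errKer n z‖)
      (Eventually.of_forall fun ρ => ?_) (Eventually.of_forall fun ρ => Eventually.of_forall
        fun z => ?_) hki.norm ?_
    · exact ((hψd.continuous.comp (continuous_const_smul _)).mul hkc).aestronglyMeasurable
    · rw [norm_mul]
      exact mul_le_of_le_one_left (norm_nonneg _) (hψ1 _)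
    · have : NeZero n := ⟨by omega⟩
      have hz0 : ∀ᵐ z : EuclideanSpace ℝ (Fin n), z ≠ 0 := by
        simp [ae_iff]
      filter_upwards [hz0] with z hz
      have h1 : Tendsto (fun ρ : ℝ => ‖ρ • z‖ ^ 2 + 1) atTop atTop := by
        refine tendsto_atTop_add_const_right _ _ ((tendsto_pow_atTop two_ne_zero).comp ?_)
        simp only [norm_smul]
        exact tendsto_norm_atTop_atTop.atTop_mul_const (norm_pos_iff.2 hz)
      have h2 := ((tendsto_rpow_neg_atTop (neg_pos.2 hs0)).comp h1).mul_const (errKer n z)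
      simpa [Function.comp_def] using h2
  have hA : ∫ z, errKer n z ≤ G 1 := by
    refine le_of_tendsto hlim0 ?_
    filter_upwards [Ioc_mem_nhdsGT (show (0 : ℝ) < 1 / 2 by norm_num)] with σ hσ
    exact hmono hσ.1 (by linarith [hσ.2])
  have hB : G 4 ≤ 0 := by
    refine ge_of_tendsto hliminf ?_
    filter_upwards [eventually_ge_atTop 8] with ρ hρ
    exact hmono (by norm_num) (by linarith)
  linarith

end Kernel

section PowerIntegrals

variable {n : ℕ}

lemma integrableOn_ball_norm_rpow (hn : 1 ≤ n) {s : ℝ} (hs : s < n) (R : ℝ) :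
    IntegrableOn (fun y : EuclideanSpace ℝ (Fin n) => ‖y‖ ^ (-s)) (ball 0 R) := by
  refine integrableOn_ball_of_norm_le_rpow (C := 1) (α := s) (by simpa using hn) (by simpa using hs)
    (Eventually.of_forall fun y => ?_) (measurable_norm.pow_const _).aestronglyMeasurable
  rw [one_mul, Real.norm_of_nonneg (Real.rpow_nonneg (norm_nonneg _) _)]

lemma setIntegral_ball_norm_rpow (s : ℝ) {R : ℝ} (hR : 0 < R) :
    ∫ y in ball (0 : EuclideanSpace ℝ (Fin n)) R, ‖y‖ ^ (-s) =
      R ^ (n - s) * ∫ y in ball (0 : EuclideanSpace ℝ (Fin n)) 1, ‖y‖ ^ (-s) := by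
  have h := Measure.setIntegral_comp_smul_of_pos
    (volume : Measure (EuclideanSpace ℝ (Fin n))) (fun y => ‖y‖ ^ (-s)) (ball 0 1) hR
  have hball : R • ball (0 : EuclideanSpace ℝ (Fin n)) 1 = ball 0 R := by
    rw [smul_unitBall hR.ne', Real.norm_of_nonneg hR.le]
  have h2 : (fun y : EuclideanSpace ℝ (Fin n) => ‖R • y‖ ^ (-s)) =
      fun y => R ^ (-s) * ‖y‖ ^ (-s) := by
    ext y
    rw [norm_smul, Real.norm_of_nonneg hR.le, Real.mul_rpow hR.le (norm_nonneg _)]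
  rw [h2, hball, integral_const_mul, finrank_euclideanSpace, Fintype.card_fin, smul_eq_mul] at h
  rw [sub_eq_add_neg, Real.rpow_add hR, Real.rpow_natCast, mul_assoc, h]
  field_simp

lemma integrableOn_compl_ball_norm_rpow {s : ℝ} (hs : n < s) {R : ℝ} (hR : 0 < R) :
    IntegrableOn (fun y : EuclideanSpace ℝ (Fin n) => ‖y‖ ^ (-s)) (ball 0 R)ᶜ := by
  have h := (integrable_one_add_norm (μ := (volume : Measure (EuclideanSpace ℝ (Fin n)))) (r := s)
    (by simpa using hs)).const_mul ((R⁻¹ + 1) ^ s)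
  refine h.integrableOn.mono' (measurable_norm.pow_const _).aestronglyMeasurable ?_
  filter_upwards [ae_restrict_mem measurableSet_ball.compl] with y hy
  have hy : R ≤ ‖y‖ := by simpa using hy
  have hy0 : 0 < ‖y‖ := hR.trans_le hy
  have hs0 : 0 ≤ s := (Nat.cast_nonneg n).trans hs.le
  rw [Real.norm_of_nonneg (Real.rpow_nonneg (norm_nonneg _) _), Real.rpow_neg hy0.le,
    Real.rpow_neg (by positivity), ← div_eq_mul_inv, ← Real.div_rpow (by positivity) (by positivity),
    ← Real.inv_rpow hy0.le]
  refine Real.rpow_le_rpow (by positivity) ?_ hs0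
  rw [le_div_iff₀ (by positivity), mul_add, mul_one, inv_mul_cancel₀ hy0.ne']
  gcongr

lemma setIntegral_compl_ball_norm_rpow (s : ℝ) {R : ℝ} (hR : 0 < R) :
    ∫ y in (ball (0 : EuclideanSpace ℝ (Fin n)) R)ᶜ, ‖y‖ ^ (-s) =
      R ^ (n - s) * ∫ y in (ball (0 : EuclideanSpace ℝ (Fin n)) 1)ᶜ, ‖y‖ ^ (-s) := by
  have h := Measure.setIntegral_comp_smul_of_pos
    (volume : Measure (EuclideanSpace ℝ (Fin n))) (fun y => ‖y‖ ^ (-s)) (ball 0 1)ᶜ hR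
  have hball : R • (ball (0 : EuclideanSpace ℝ (Fin n)) 1)ᶜ = (ball 0 R)ᶜ := by
    ext y
    rw [Set.mem_smul_set_iff_inv_smul_mem₀ hR.ne']
    simp [norm_inv_smul_eq hR, one_le_div₀ hR]
  have h2 : (fun y : EuclideanSpace ℝ (Fin n) => ‖R • y‖ ^ (-s)) =
      fun y => R ^ (-s) * ‖y‖ ^ (-s) := by
    ext y
    rw [norm_smul, Real.norm_of_nonneg hR.le, Real.mul_rpow hR.le (norm_nonneg _)]
  rw [h2, hball, integral_const_mul, finrank_euclideanSpace, Fintype.card_fin, smul_eq_mul] at h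
  rw [sub_eq_add_neg, Real.rpow_add hR, Real.rpow_natCast, mul_assoc, h]
  field_simp

lemma integrable_indicator_ball_sub_rpow (hn : 1 ≤ n) {s : ℝ} (hs : s < n) (R : ℝ)
    (x : EuclideanSpace ℝ (Fin n)) :
    Integrable (fun y => (ball (0 : EuclideanSpace ℝ (Fin n)) R).indicator
      (fun z => ‖z‖ ^ (-s)) (x - y)) :=
  ((integrableOn_ball_norm_rpow hn hs R).integrable_indicator measurableSet_ball).comp_sub_left x

lemma integral_indicator_ball_sub_rpow (s : ℝ) {R : ℝ} (hR : 0 < R)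
    (x : EuclideanSpace ℝ (Fin n)) :
    ∫ y, (ball (0 : EuclideanSpace ℝ (Fin n)) R).indicator (fun z => ‖z‖ ^ (-s)) (x - y) =
      R ^ (n - s) * ∫ y in ball (0 : EuclideanSpace ℝ (Fin n)) 1, ‖y‖ ^ (-s) := by
  rw [integral_sub_left_eq_self (fun y =>
    (ball (0 : EuclideanSpace ℝ (Fin n)) R).indicator (fun z => ‖z‖ ^ (-s)) y) _ x,
    integral_indicator measurableSet_ball, setIntegral_ball_norm_rpow s hR]

/-- A Hardy-type bound: the Riesz kernel of order `4` maps `|y| ^ (-4-a)` to a multiple of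
`|x| ^ (-a)`. -/
lemma exists_integral_riesz_rpow_le (hn : 5 ≤ n) {a : ℝ} (ha : 0 < a) (han : a < n - 4) :
    ∃ C : ℝ, 0 ≤ C ∧ ∀ x : EuclideanSpace ℝ (Fin n), x ≠ 0 →
      Integrable (fun y => ‖x - y‖ ^ (4 - n : ℝ) * ‖y‖ ^ (-4 - a)) ∧
      ∫ y, ‖x - y‖ ^ (4 - n : ℝ) * ‖y‖ ^ (-4 - a) ≤ C * ‖x‖ ^ (-a) := by
  have hn' : (5 : ℝ) ≤ n := by exact_mod_cast hn
  have hn1 : 1 ≤ n := by omega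
  set I1 := ∫ y in ball (0 : EuclideanSpace ℝ (Fin n)) 1, ‖y‖ ^ (-(4 + a)) with hI1
  set I2 := ∫ y in ball (0 : EuclideanSpace ℝ (Fin n)) 1, ‖y‖ ^ (-(n - 4 : ℝ)) with hI2
  set I3 := ∫ y in (ball (0 : EuclideanSpace ℝ (Fin n)) 1)ᶜ, ‖y‖ ^ (-(n + a)) with hI3
  have hI1p : 0 ≤ I1 := integral_nonneg fun y => Real.rpow_nonneg (norm_nonneg _) _
  have hI2p : 0 ≤ I2 := integral_nonneg fun y => Real.rpow_nonneg (norm_nonneg _) _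
  have hI3p : 0 ≤ I3 := integral_nonneg fun y => Real.rpow_nonneg (norm_nonneg _) _
  refine ⟨(1 / 2) ^ (4 - n : ℝ) * ((1 / 2) ^ (n - (4 + a)) * I1) +
    (1 / 2) ^ (-4 - a) * (2 ^ (4 : ℝ) * I2) + (1 / 2) ^ (-4 - a) * (2 ^ (-a) * I3),
    by positivity, fun x hx => ?_⟩
  have hx0 : 0 < ‖x‖ := norm_pos_iff.2 hx
  set D1 : EuclideanSpace ℝ (Fin n) → ℝ := fun y => (‖x‖ / 2) ^ (4 - n : ℝ) *
    (ball (0 : EuclideanSpace ℝ (Fin n)) (‖x‖ / 2)).indicator (fun z => ‖z‖ ^ (-(4 + a))) (0 - y)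
    with hD1
  set D2 : EuclideanSpace ℝ (Fin n) → ℝ := fun y => (‖x‖ / 2) ^ (-4 - a) *
    (ball (0 : EuclideanSpace ℝ (Fin n)) (2 * ‖x‖)).indicator (fun z => ‖z‖ ^ (-(n - 4 : ℝ))) (x - y)
    with hD2
  set D3 : EuclideanSpace ℝ (Fin n) → ℝ := fun y => (1 / 2) ^ (-4 - a) *
    ((ball (0 : EuclideanSpace ℝ (Fin n)) (2 * ‖x‖))ᶜ).indicator (fun z => ‖z‖ ^ (-(n + a))) (x - y)
    with hD3
  have i1 : Integrable D1 :=
    (integrable_indicator_ball_sub_rpow hn1 (by linarith) _ _).const_mul _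
  have i2 : Integrable D2 :=
    (integrable_indicator_ball_sub_rpow hn1 (by linarith) _ _).const_mul _
  have i3 : Integrable D3 :=
    (((integrableOn_compl_ball_norm_rpow (by linarith) (by positivity)).integrable_indicator
      measurableSet_ball.compl).comp_sub_left x).const_mul _
  have e1 : ∫ y, D1 y = (‖x‖ / 2) ^ (4 - n : ℝ) * ((‖x‖ / 2) ^ (n - (4 + a)) * I1) := by
    rw [hD1, integral_const_mul, integral_indicator_ball_sub_rpow _ (by positivity)]
  have e2 : ∫ y, D2 y = (‖x‖ / 2) ^ (-4 - a) * ((2 * ‖x‖) ^ (4 : ℝ) * I2) := by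
    rw [hD2, integral_const_mul, integral_indicator_ball_sub_rpow _ (by positivity)]
    congr 4
    ring
  have e3 : ∫ y, D3 y = (1 / 2) ^ (-4 - a) * ((2 * ‖x‖) ^ (-a) * I3) := by
    rw [hD3, integral_const_mul, integral_sub_left_eq_self (fun y =>
      ((ball (0 : EuclideanSpace ℝ (Fin n)) (2 * ‖x‖))ᶜ).indicator (fun z => ‖z‖ ^ (-(n + a))) y) _ x,
      integral_indicator measurableSet_ball.compl,
      setIntegral_compl_ball_norm_rpow _ (by positivity)]
    congr 4
    ring
  have d1 (y) : 0 ≤ D1 y := mul_nonneg (by positivity)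
    (Set.indicator_nonneg (fun z _ => Real.rpow_nonneg (norm_nonneg _) _) _)
  have d2 (y) : 0 ≤ D2 y := mul_nonneg (by positivity)
    (Set.indicator_nonneg (fun z _ => Real.rpow_nonneg (norm_nonneg _) _) _)
  have d3 (y) : 0 ≤ D3 y := mul_nonneg (by positivity)
    (Set.indicator_nonneg (fun z _ => Real.rpow_nonneg (norm_nonneg _) _) _)
  have hle (y) : ‖x - y‖ ^ (4 - n : ℝ) * ‖y‖ ^ (-4 - a) ≤ D1 y + D2 y + D3 y := by
    have htri : ‖x‖ ≤ ‖x - y‖ + ‖y‖ := by simpa using norm_add_le (x - y) y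
    have htri2 : ‖x - y‖ ≤ ‖x‖ + ‖y‖ := norm_sub_le x y
    rcases lt_or_ge ‖y‖ (‖x‖ / 2) with h | h
    · have : D1 y = (‖x‖ / 2) ^ (4 - n : ℝ) * ‖y‖ ^ (-4 - a) := by
        simp only [hD1]
        rw [Set.indicator_of_mem (by simpa using h), zero_sub, norm_neg]
        congr 2
        ring
      have h2 : ‖x - y‖ ^ (4 - n : ℝ) ≤ (‖x‖ / 2) ^ (4 - n : ℝ) :=
        Real.rpow_le_rpow_of_nonpos (by positivity) (by linarith) (by linarith)
      have := mul_le_mul_of_nonneg_right h2 (Real.rpow_nonneg (norm_nonneg y) (-4 - a))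
      linarith [d2 y, d3 y]
    rcases lt_or_ge ‖x - y‖ (2 * ‖x‖) with h' | h'
    · have : D2 y = (‖x‖ / 2) ^ (-4 - a) * ‖x - y‖ ^ (4 - n : ℝ) := by
        simp only [hD2]
        rw [Set.indicator_of_mem (by simpa using h')]
        congr 2
        ring
      have h2 : ‖y‖ ^ (-4 - a) ≤ (‖x‖ / 2) ^ (-4 - a) :=
        Real.rpow_le_rpow_of_nonpos (by positivity) (by linarith) (by linarith)
      have := mul_le_mul_of_nonneg_left h2 (Real.rpow_nonneg (norm_nonneg (x - y)) (4 - n))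
      linarith [d1 y, d3 y]
    · have hz : 0 < ‖x - y‖ := by linarith
      have : D3 y = ‖x - y‖ ^ (4 - n : ℝ) * (1 / 2 * ‖x - y‖) ^ (-4 - a) := by
        simp only [hD3]
        rw [Set.indicator_of_mem (by simpa using h'), Real.mul_rpow (by norm_num) hz.le,
          mul_left_comm, ← Real.rpow_add hz]
        congr 2
        ring
      have h2 : ‖y‖ ^ (-4 - a) ≤ (1 / 2 * ‖x - y‖) ^ (-4 - a) :=
        Real.rpow_le_rpow_of_nonpos (by positivity) (by linarith) (by linarith)
      have := mul_le_mul_of_nonneg_left h2 (Real.rpow_nonneg (norm_nonneg (x - y)) (4 - n))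
      linarith [d1 y, d2 y]
  have hpos (y) : 0 ≤ ‖x - y‖ ^ (4 - n : ℝ) * ‖y‖ ^ (-4 - a) := by positivity
  have hint : Integrable (fun y => ‖x - y‖ ^ (4 - n : ℝ) * ‖y‖ ^ (-4 - a)) := by
    refine ((i1.add i2).add i3).mono' ?_ (Eventually.of_forall fun y => ?_)
    · exact (((measurable_const.sub measurable_id).norm.pow_const _).mul
        (measurable_norm.pow_const _)).aestronglyMeasurable
    · rw [Real.norm_of_nonneg (hpos y)]
      exact hle y
  refine ⟨hint, (integral_mono hint ((i1.add i2).add i3) hle).trans (le_of_eq ?_)⟩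
  rw [integral_add' (i1.add i2) i3, integral_add' i1 i2, e1, e2, e3]
  have k1 : (‖x‖ / 2) ^ (4 - n : ℝ) * ((‖x‖ / 2) ^ (n - (4 + a)) * I1) =
      (1 / 2) ^ (4 - n : ℝ) * ((1 / 2) ^ (n - (4 + a)) * I1) * ‖x‖ ^ (-a) := by
    rw [div_eq_mul_one_div, Real.mul_rpow hx0.le (by norm_num), Real.mul_rpow hx0.le (by norm_num),
      show -a = (4 - n : ℝ) + (n - (4 + a)) by ring, Real.rpow_add hx0]
    ring
  have k2 : (‖x‖ / 2) ^ (-4 - a) * ((2 * ‖x‖) ^ (4 : ℝ) * I2) =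
      (1 / 2) ^ (-4 - a) * (2 ^ (4 : ℝ) * I2) * ‖x‖ ^ (-a) := by
    rw [div_eq_mul_one_div, Real.mul_rpow hx0.le (by norm_num), Real.mul_rpow (by norm_num) hx0.le,
      show ‖x‖ ^ (-a) = ‖x‖ ^ (-4 - a) * ‖x‖ ^ (4 : ℝ) by rw [← Real.rpow_add hx0]; ring_nf]
    ring
  have k3 : (2 * ‖x‖) ^ (-a) = 2 ^ (-a) * ‖x‖ ^ (-a) := Real.mul_rpow (by norm_num) hx0.le
  rw [k1, k2, k3]
  ring

lemma riesz_mul_rpow_le {b : ℝ} (hb : 0 < b) (hn : 5 ≤ n) (x y : EuclideanSpace ℝ (Fin n)) :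
    ‖x - y‖ ^ (4 - n : ℝ) * ‖y‖ ^ (-b) ≤
      ‖x - y‖ ^ (-(n - 4 + b : ℝ)) + ‖y‖ ^ (-(n - 4 + b : ℝ)) := by
  have hn' : (5 : ℝ) ≤ n := by exact_mod_cast hn
  have p1 : 0 ≤ ‖x - y‖ ^ (-(n - 4 + b : ℝ)) := Real.rpow_nonneg (norm_nonneg _) _
  have p2 : 0 ≤ ‖y‖ ^ (-(n - 4 + b : ℝ)) := Real.rpow_nonneg (norm_nonneg _) _
  rcases (norm_nonneg (x - y)).eq_or_lt' with h | h
  · rw [h, Real.zero_rpow (by linarith), zero_mul]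
    rw [h] at p1
    positivity
  rcases (norm_nonneg y).eq_or_lt' with h' | h'
  · rw [h', Real.zero_rpow (by linarith : -b ≠ 0), mul_zero]
    rw [h'] at p2
    positivity
  rw [show -(n - 4 + b : ℝ) = (4 - n) + (-b) by ring, Real.rpow_add h, Real.rpow_add h']
  rw [show -(n - 4 + b : ℝ) = (4 - n) + (-b) by ring, Real.rpow_add h] at p1
  rw [show -(n - 4 + b : ℝ) = (4 - n) + (-b) by ring, Real.rpow_add h'] at p2
  rcases le_total ‖x - y‖ ‖y‖ with hle | hle
  · have := Real.rpow_le_rpow_of_nonpos h hle (by linarith : -b ≤ 0)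
    have := mul_le_mul_of_nonneg_left this (Real.rpow_nonneg h.le (4 - n))
    linarith
  · have := Real.rpow_le_rpow_of_nonpos h' hle (by linarith : (4 - n : ℝ) ≤ 0)
    have := mul_le_mul_of_nonneg_right this (Real.rpow_nonneg h'.le (-b))
    linarith

end PowerIntegrals

section WeakForm

variable {n : ℕ}

lemma norm_iteratedFDeriv_lap_le {g : EuclideanSpace ℝ (Fin n) → ℝ} {k m : ℕ} (hg : ContDiff ℝ m g)
    (hk : k + 2 ≤ m) (y : EuclideanSpace ℝ (Fin n)) :
    ‖iteratedFDeriv ℝ k (lap g) y‖ ≤ n * ‖iteratedFDeriv ℝ (k + 2) g y‖ := by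
  have h1 : lap g = fun x => ∑ i : Fin n,
      fderiv ℝ (fun z => fderiv ℝ g z (EuclideanSpace.single i 1)) x (EuclideanSpace.single i 1) :=
    funext fun x => by
      have hd : DifferentiableAt ℝ (fderiv ℝ g) x :=
        ((hg.fderiv_right (m := 1) (by norm_cast; omega)).differentiable one_ne_zero) x
      simp [lap_eq_sum_fderiv, fderiv_clm_apply hd (differentiableAt_const _)]
  have hd1 (i : Fin n) : ContDiff ℝ (k + 1 : ℕ) fun z => fderiv ℝ g z (EuclideanSpace.single i 1) :=
    (hg.fderiv_right (m := (k + 1 : ℕ)) (by norm_cast)).clm_apply contDiff_const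
  have hd2 (i : Fin n) : ContDiff ℝ k fun x =>
      fderiv ℝ (fun z => fderiv ℝ g z (EuclideanSpace.single i 1)) x (EuclideanSpace.single i 1) :=
    ((hd1 i).fderiv_right (m := k) (by norm_cast)).clm_apply contDiff_const
  have key {h : EuclideanSpace ℝ (Fin n) → ℝ} {l : ℕ} (hh : ContDiff ℝ (l + 1 : ℕ) h) (i : Fin n) :
      ‖iteratedFDeriv ℝ l (fun z => fderiv ℝ h z (EuclideanSpace.single i 1)) y‖ ≤
        ‖iteratedFDeriv ℝ (l + 1) h y‖ := by
    have := norm_iteratedFDeriv_clm_apply_const (x := y) (c := EuclideanSpace.single i (1 : ℝ))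
      (hh.fderiv_right (m := l) (by norm_cast)).contDiffAt le_rfl
    rwa [norm_iteratedFDeriv_fderiv, PiLp.norm_single, norm_one, one_mul] at this
  rw [h1, iteratedFDeriv_fun_sum_apply fun i _ => (hd2 i).contDiffAt]
  calc _ ≤ ∑ i : Fin n, ‖iteratedFDeriv ℝ (k + 2) g y‖ :=
        norm_sum_le_of_le _ fun i _ => (key (hd1 i) i).trans
          (key (l := k + 1) (hg.of_le (by norm_cast)) i)
    _ = _ := by simp

lemma abs_bilap_le {g : EuclideanSpace ℝ (Fin n) → ℝ} (hg : ContDiff ℝ ∞ g)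
    (y : EuclideanSpace ℝ (Fin n)) :
    |bilap g y| ≤ n * (n * ‖iteratedFDeriv ℝ 4 g y‖) := by
  have hlap : ContDiff ℝ (2 : ℕ) (lap g) := contDiff_iff_contDiffAt.2 fun x =>
    contDiffAt_lap hg.contDiffAt (by norm_cast)
  have h1 := norm_iteratedFDeriv_lap_le (k := 0) (m := 2) hlap (by norm_num) y
  have h2 := norm_iteratedFDeriv_lap_le (k := 2) (m := 4) (hg.of_le (by norm_cast)) (by norm_num) y
  rw [norm_iteratedFDeriv_zero, Real.norm_eq_abs] at h1
  exact h1.trans (by simpa using mul_le_mul_of_nonneg_left h2 (Nat.cast_nonneg n))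

lemma exists_norm_iteratedFDeriv_le {g : EuclideanSpace ℝ (Fin n) → ℝ} (hg : ContDiff ℝ ∞ g)
    (hgc : HasCompactSupport g) (N : ℕ) :
    ∃ C, 0 ≤ C ∧ ∀ k ≤ N, ∀ y, ‖iteratedFDeriv ℝ k g y‖ ≤ C := by
  have h (k : ℕ) : ∃ C, ∀ y, ‖iteratedFDeriv ℝ k g y‖ ≤ C :=
    (hgc.iteratedFDeriv k).exists_bound_of_continuous
      (hg.continuous_iteratedFDeriv (by exact_mod_cast le_top))
  choose C hC using h
  refine ⟨∑ k ∈ Finset.range (N + 1), C k, Finset.sum_nonneg fun k _ =>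
    (norm_nonneg _).trans (hC k 0), fun k hk y => (hC k y).trans ?_⟩
  exact Finset.single_le_sum (f := C) (fun k _ => (norm_nonneg _).trans (hC k 0))
    (Finset.mem_range.2 (by omega))

lemma contDiff_cutoff_smul (ε : ℝ) :
    ContDiff ℝ ∞ fun y : EuclideanSpace ℝ (Fin n) => cutoff n (ε⁻¹ • y) :=
  (cutoff n).contDiff.comp (contDiff_const_smul _)

lemma exists_abs_bilap_cutoff_mul_le {φ : EuclideanSpace ℝ (Fin n) → ℝ} (hφ : ContDiff ℝ ∞ φ)
    (hφc : HasCompactSupport φ) :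
    ∃ C, 0 ≤ C ∧ ∀ ε, 0 < ε → ε ≤ 1 → ∀ y,
      |bilap (fun y => cutoff n (ε⁻¹ • y) * φ y) y| ≤ C * (ε⁻¹) ^ 4 := by
  obtain ⟨A, hA0, hA⟩ := exists_norm_iteratedFDeriv_le (cutoff n).contDiff
    (cutoff n).hasCompactSupport 4
  obtain ⟨B, hB0, hB⟩ := exists_norm_iteratedFDeriv_le hφ hφc 4
  refine ⟨n * (n * (∑ i ∈ Finset.range 5, (Nat.choose 4 i : ℝ) * A * B)), by positivity,
    fun ε hε hε1 y => (abs_bilap_le ((contDiff_cutoff_smul ε).mul hφ) y).trans ?_⟩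
  have h1 : 1 ≤ ε⁻¹ := (one_le_inv₀ hε).2 hε1
  rw [mul_assoc, mul_assoc]
  gcongr
  refine (norm_iteratedFDeriv_mul_le (N := ∞) (contDiff_cutoff_smul ε) hφ y
    (by norm_cast)).trans ?_
  rw [Finset.sum_mul]
  refine Finset.sum_le_sum fun i hi => ?_
  have hi : i ≤ 4 := by have := Finset.mem_range.1 hi; omega
  have hs : ‖iteratedFDeriv ℝ i (fun y => cutoff n (ε⁻¹ • y)) y‖ ≤ A * ε⁻¹ ^ 4 := by
    have := congrFun (iteratedFDeriv_comp_const_smul (𝕜 := ℝ) (i := i) ε⁻¹ (cutoff n).contDiff) y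
    rw [this, norm_smul, norm_pow,
      Real.norm_of_nonneg (by positivity), mul_comm]
    exact mul_le_mul (hA i hi _) (pow_le_pow_right₀ h1 hi) (by positivity) hA0
  calc _ ≤ (Nat.choose 4 i : ℝ) * (A * ε⁻¹ ^ 4) * B := by
        gcongr
        exact hB _ (by omega) _
    _ = _ := by ring

lemma le_add_rpow_mul_rpow {s l q : ℝ} (hs : 0 ≤ s) (hl : 0 < l) (hq : 1 ≤ q) :
    s ≤ l + l ^ (1 - q) * s ^ q := by
  rcases le_total s l with h | h
  · exact h.trans (le_add_of_nonneg_right (by positivity))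
  · have h1 : 1 ≤ s / l := (one_le_div hl).2 h
    have h2 := Real.rpow_le_rpow_of_exponent_le h1 hq
    rw [Real.rpow_one, Real.div_rpow hs hl.le, div_le_iff₀ hl] at h2
    rw [Real.rpow_sub hl, Real.rpow_one]
    have : l / l ^ q * s ^ q = s ^ q / l ^ q * l := by ring
    linarith

lemma setIntegral_ball_le_of_rpow {U : EuclideanSpace ℝ (Fin n) → ℝ} {q α η t : ℝ}
    {x : EuclideanSpace ℝ (Fin n)} (hq : 1 < q) (hα : α * q = n) (hη : 0 < η) (ht : 0 < t)
    (hU0 : ∀ y, 0 ≤ U y) (hU : Integrable U) (hUq : Integrable fun y => U y ^ q)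
    (hE : ∫ y in ball x t, U y ^ q ≤ η ^ q) :
    ∫ y in ball x t, U y ≤
      (volume.real (ball (0 : EuclideanSpace ℝ (Fin n)) 1) + 1) * (η * t ^ (n - α)) := by
  set l := η * t ^ (-α) with hl
  have hl0 : 0 < l := by positivity
  have hfin : volume (ball x t) ≠ ⊤ := measure_ball_lt_top.ne
  have hvol : volume.real (ball x t) =
      t ^ (n : ℝ) * volume.real (ball (0 : EuclideanSpace ℝ (Fin n)) 1) := by
    rw [measureReal_def, Measure.addHaar_ball_of_pos _ _ ht, ENNReal.toReal_mul,
      ENNReal.toReal_ofReal (by positivity), finrank_euclideanSpace, Fintype.card_fin,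
      Real.rpow_natCast, measureReal_def]
  calc ∫ y in ball x t, U y ≤ ∫ y in ball x t, (l + l ^ (1 - q) * U y ^ q) :=
        setIntegral_mono hU.integrableOn
          ((integrableOn_const hfin).add (hUq.integrableOn.const_mul _))
          fun y => le_add_rpow_mul_rpow (hU0 y) hl0 hq.le
    _ = volume.real (ball x t) * l + l ^ (1 - q) * ∫ y in ball x t, U y ^ q := by
        rw [integral_add (integrableOn_const (C := l) hfin) (hUq.integrableOn.const_mul _),
          setIntegral_const, integral_const_mul, smul_eq_mul]
    _ ≤ volume.real (ball x t) * l + l ^ (1 - q) * η ^ q := by gcongr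
    _ = _ := by
      have e1 : l ^ (1 - q) * η ^ q = η * t ^ (n - α) := by
        rw [hl, Real.mul_rpow hη.le (by positivity), ← Real.rpow_mul ht.le,
          show -α * (1 - q) = n - α by rw [← hα]; ring, mul_right_comm, ← Real.rpow_add hη]
        simp
      have e2 : t ^ (n - α) = t ^ (n : ℝ) * t ^ (-α) := by rw [← Real.rpow_add ht]; ring_nf
      rw [e1, hvol, hl, e2]
      ring

lemma tendsto_setIntegral_ball_zero {f : EuclideanSpace ℝ (Fin n) → ℝ} (hn : n ≠ 0)
    (hf : Integrable f) : Tendsto (fun ε : ℝ => ∫ y in ball 0 ε, f y) (𝓝[>] 0) (𝓝 0) := by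
  refine hf.tendsto_setIntegral_nhds_zero ?_
  have h1 : (fun ε : ℝ => volume (ball (0 : EuclideanSpace ℝ (Fin n)) ε)) =ᶠ[𝓝[>] 0]
      fun ε => ENNReal.ofReal (ε ^ n) * volume (ball (0 : EuclideanSpace ℝ (Fin n)) 1) := by
    filter_upwards [self_mem_nhdsWithin] with ε hε
    rw [Measure.addHaar_ball_of_pos _ _ hε, finrank_euclideanSpace, Fintype.card_fin]
  have h2 : Tendsto (fun ε : ℝ => ENNReal.ofReal (ε ^ n) *
      volume (ball (0 : EuclideanSpace ℝ (Fin n)) 1)) (𝓝 0) (𝓝 0) := by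
    have h3 : Tendsto (fun ε : ℝ => ENNReal.ofReal (ε ^ n)) (𝓝 0) (𝓝 0) := by
      have := (ENNReal.continuous_ofReal.comp (continuous_pow n)).tendsto (0 : ℝ)
      simpa [hn, Function.comp_def] using this
    simpa using ENNReal.Tendsto.mul_const h3 (Or.inr measure_ball_lt_top.ne)
  exact (h2.mono_left nhdsWithin_le_nhds).congr' h1.symm

/-- `U` and `f` are integrable and nonnegative, continuous in the punctured ball of radius `1/2`,
and `Δ²U = f` in the ball of radius `1/2` in the sense of distributions. -/
structure IsWeakSol (U f : EuclideanSpace ℝ (Fin n) → ℝ) : Prop where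
  integrable : Integrable U
  integrable_rhs : Integrable f
  nonneg : ∀ y, 0 ≤ U y
  nonneg_rhs : ∀ y, 0 ≤ f y
  continuousAt : ∀ y, y ≠ 0 → ‖y‖ < 1 / 2 → ContinuousAt U y
  continuousAt_rhs : ∀ y, y ≠ 0 → ‖y‖ < 1 / 2 → ContinuousAt f y
  weak : ∀ φ : EuclideanSpace ℝ (Fin n) → ℝ, ContDiff ℝ ∞ φ → tsupport φ ⊆ ball 0 (1 / 2) →
    ∫ y, U y * bilap φ y = ∫ y, f y * φ y

lemma weak_of_punctured {U f : EuclideanSpace ℝ (Fin n) → ℝ} {q α : ℝ} (hq : 1 < q)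
    (hα : α * q = n) (hα4 : α < n - 4) (hn : n ≠ 0) (hU0 : ∀ y, 0 ≤ U y) (hU : Integrable U)
    (hUq : Integrable fun y => U y ^ q) (hf0 : ∀ y, 0 ≤ f y) (hf : Integrable f)
    (hd : ∀ y, y ≠ 0 → ‖y‖ < 1 / 2 → ContDiffAt ℝ 4 U y)
    (heq : ∀ y, y ≠ 0 → ‖y‖ < 1 / 2 → bilap U y = f y)
    {φ : EuclideanSpace ℝ (Fin n) → ℝ} (hφ : ContDiff ℝ ∞ φ)
    (hsupp : tsupport φ ⊆ ball 0 (1 / 2)) :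
    ∫ y, U y * bilap φ y = ∫ y, f y * φ y := by
  have hφc : HasCompactSupport φ := (isCompact_closedBall (0 : EuclideanSpace ℝ (Fin n))
    (1 / 2)).of_isClosed_subset (isClosed_tsupport _) (hsupp.trans ball_subset_closedBall)
  obtain ⟨C, hC0, hC⟩ := exists_abs_bilap_cutoff_mul_le hφ hφc
  obtain ⟨B, hB⟩ := hφc.exists_bound_of_continuous hφ.continuous
  have hB0 : 0 ≤ B := (norm_nonneg _).trans (hB 0)
  set E := ∫ y, U y ^ q with hE
  have hE0 : 0 ≤ E := integral_nonneg fun y => Real.rpow_nonneg (hU0 y) _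
  set η := (E + 1) ^ (1 / q) with hη
  have hη0 : 0 < η := by positivity
  have hηq : η ^ q = E + 1 := by
    rw [hη, ← Real.rpow_mul (by positivity), one_div_mul_cancel (by positivity), Real.rpow_one]
  set V := volume.real (ball (0 : EuclideanSpace ℝ (Fin n)) 1)
  have hbφ : Continuous (bilap φ) := continuous_iff_continuousAt.2 fun y =>
    (contDiffAt_bilap (k := 0) hφ.contDiffAt (by norm_cast)).continuousAt
  have hbφc : HasCompactSupport (bilap φ) := hφc.mono'
    (subset_tsupport _ |>.trans (tsupport_lap_subset.trans tsupport_lap_subset))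
  have hint1 : Integrable fun y => U y * bilap φ y := by
    obtain ⟨B', hB'⟩ := hbφc.exists_bound_of_continuous hbφ
    exact hU.mul_bdd hbφ.aestronglyMeasurable (Eventually.of_forall hB')
  have hint2 : Integrable fun y => f y * φ y :=
    hf.mul_bdd hφ.continuous.aestronglyMeasurable (Eventually.of_forall hB)
  have bound (ε : ℝ) (hε : 0 < ε) (hε1 : ε ≤ 1) :
      |(∫ y, U y * bilap φ y) - ∫ y, f y * φ y| ≤
        C * ((V + 1) * η) * ε ^ (n - α - 4) + B * ∫ y in ball 0 ε, f y := by
    set ζ : EuclideanSpace ℝ (Fin n) → ℝ := fun y => cutoff n (ε⁻¹ • y) with hζ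
    have hζd : ContDiff ℝ ∞ ζ := contDiff_cutoff_smul ε
    have hζφ : ContDiff ℝ ∞ fun y => ζ y * φ y := hζd.mul hφ
    have hζ0 (y) (hy : ε / 2 ≤ ‖y‖) : ζ y = 0 := by
      apply cutoff_eq_zero
      rw [norm_inv_smul_eq hε, le_div_iff₀ hε]
      linarith
    have hζ1 (y) (hy : ‖y‖ ≤ ε / 4) : ζ y = 1 := by
      apply cutoff_eq_one
      rw [norm_inv_smul_eq hε, div_le_iff₀ hε]
      linarith
    have hζb (y) : |ζ y| ≤ 1 := by
      rw [abs_of_nonneg (cutoff n).nonneg]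
      exact (cutoff n).le_one
    have hbz (y) (hy : ε ≤ ‖y‖) : bilap (fun y => ζ y * φ y) y = 0 := by
      apply bilap_eq_zero_of_eventuallyEq_zero
      filter_upwards [continuous_norm.continuousAt.eventually
        (lt_mem_nhds (show ε / 2 < ‖y‖ by linarith))] with z hz
      rw [hζ0 z hz.le, zero_mul]
    set ψ : EuclideanSpace ℝ (Fin n) → ℝ := fun y => φ y - ζ y * φ y with hψ
    have hψd : ContDiff ℝ ∞ ψ := hφ.sub hζφ
    have hψs : tsupport ψ ⊆ tsupport φ := by
      refine closure_mono fun y hy => ?_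
      simp only [Function.mem_support, hψ] at hy ⊢
      contrapose! hy
      simp [hy]
    have hψ0 (y) (hy : y ∈ tsupport ψ) : y ≠ 0 := by
      rintro rfl
      refine (notMem_tsupport_iff_eventuallyEq.2 ?_) hy
      filter_upwards [ball_mem_nhds (0 : EuclideanSpace ℝ (Fin n)) (show 0 < ε / 4 by positivity)]
        with z hz
      simp [hψ, hζ1 z (by simpa using (mem_ball_zero_iff.1 hz).le)]
    have hn2 (y) (hy : y ∈ tsupport ψ) : ‖y‖ < 1 / 2 := mem_ball_zero_iff.1 (hsupp (hψs hy))
    have main : ∫ y, U y * bilap ψ y = ∫ y, f y * ψ y := by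
      rw [integral_mul_bilap (fun y hy => hd y (hψ0 y hy) (hn2 y hy))
        (hψd.of_le (by norm_cast)) (hφc.mono' ((subset_tsupport _).trans hψs))]
      refine integral_congr_ae (Eventually.of_forall fun y => ?_)
      by_cases hy : y ∈ tsupport ψ
      · simp only [heq y (hψ0 y hy) (hn2 y hy)]
      · simp [image_eq_zero_of_notMem_tsupport hy]
    have hb4 : Continuous (bilap fun y => ζ y * φ y) := continuous_iff_continuousAt.2 fun y =>
      (contDiffAt_bilap (k := 0) hζφ.contDiffAt (by norm_cast)).continuousAt
    have hint3 : Integrable fun y => U y * bilap (fun y => ζ y * φ y) y :=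
      hU.mul_bdd hb4.aestronglyMeasurable (Eventually.of_forall fun y => hC ε hε hε1 y)
    have hint4 : Integrable fun y => f y * (ζ y * φ y) :=
      hf.mul_bdd (c := B) hζφ.continuous.aestronglyMeasurable (Eventually.of_forall fun y => by
        rw [norm_mul]
        exact (mul_le_of_le_one_left (norm_nonneg _) (hζb y)).trans (hB y))
    have e1 : ∫ y, U y * bilap ψ y =
        (∫ y, U y * bilap φ y) - ∫ y, U y * bilap (fun y => ζ y * φ y) y := by
      rw [← integral_sub hint1 hint3]
      refine integral_congr_ae (Eventually.of_forall fun y => ?_)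
      simp only [hψ]
      rw [bilap_sub (hφ.contDiffAt.of_le (by norm_cast)) (hζφ.contDiffAt.of_le (by norm_cast))]
      ring
    have e2 : ∫ y, f y * ψ y = (∫ y, f y * φ y) - ∫ y, f y * (ζ y * φ y) := by
      rw [← integral_sub hint2 hint4]
      refine integral_congr_ae (Eventually.of_forall fun y => ?_)
      simp only [hψ]
      ring
    have e3 : |∫ y, U y * bilap (fun y => ζ y * φ y) y| ≤
        C * ((V + 1) * η) * ε ^ (n - α - 4) := by
      have s1 : ∫ y, U y * bilap (fun y => ζ y * φ y) y =
          ∫ y in ball 0 ε, U y * bilap (fun y => ζ y * φ y) y := by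
        refine (setIntegral_eq_integral_of_forall_compl_eq_zero fun y hy => ?_).symm
        rw [hbz y (by simpa using hy), mul_zero]
      have s2 : |∫ y in ball 0 ε, U y * bilap (fun y => ζ y * φ y) y| ≤
          ∫ y in ball 0 ε, U y * (C * ε⁻¹ ^ 4) := by
        rw [← Real.norm_eq_abs]
        refine norm_integral_le_of_norm_le (hU.integrableOn.mul_const _)
          (Eventually.of_forall fun y => ?_)
        rw [norm_mul, Real.norm_of_nonneg (hU0 y)]
        exact mul_le_mul_of_nonneg_left (hC ε hε hε1 y) (hU0 y)
      have s3 := setIntegral_ball_le_of_rpow (x := 0) hq hα hη0 hε hU0 hU hUq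
        ((setIntegral_le_integral hUq
          (Eventually.of_forall fun y => Real.rpow_nonneg (hU0 y) _)).trans (by rw [hηq]; linarith))
      rw [s1]
      refine s2.trans ?_
      rw [integral_mul_const]
      refine (mul_le_mul_of_nonneg_right s3 (by positivity)).trans (le_of_eq ?_)
      rw [show (n - α - 4 : ℝ) = (n - α) - (4 : ℕ) by norm_num, Real.rpow_sub_natCast hε.ne']
      simp only [V]
      field_simp
    have e4 : |∫ y, f y * (ζ y * φ y)| ≤ B * ∫ y in ball 0 ε, f y := by
      have s1 : ∫ y, f y * (ζ y * φ y) = ∫ y in ball 0 ε, f y * (ζ y * φ y) := by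
        refine (setIntegral_eq_integral_of_forall_compl_eq_zero fun y hy => ?_).symm
        have : ε ≤ ‖y‖ := by simpa using hy
        rw [hζ0 y (by linarith), zero_mul, mul_zero]
      rw [s1, ← integral_const_mul, ← Real.norm_eq_abs]
      refine norm_integral_le_of_norm_le (hf.integrableOn.const_mul _)
        (Eventually.of_forall fun y => ?_)
      rw [norm_mul, Real.norm_of_nonneg (hf0 y), mul_comm B, norm_mul]
      exact mul_le_mul_of_nonneg_left
        ((mul_le_of_le_one_left (norm_nonneg _) (hζb y)).trans (hB y)) (hf0 y)
    have e5 : (∫ y, U y * bilap φ y) - ∫ y, f y * φ y =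
        (∫ y, U y * bilap (fun y => ζ y * φ y) y) - ∫ y, f y * (ζ y * φ y) := by
      linarith
    rw [e5]
    exact (abs_sub _ _).trans (add_le_add e3 e4)
  have hlim : Tendsto (fun ε : ℝ => C * ((V + 1) * η) * ε ^ (n - α - 4) +
      B * ∫ y in ball 0 ε, f y) (𝓝[>] 0) (𝓝 (C * ((V + 1) * η) * 0 + B * 0)) := by
    refine (Tendsto.const_mul _ ?_).add (Tendsto.const_mul _ ?_)
    · have := (Real.continuousAt_rpow_const 0 (n - α - 4) (Or.inr (by linarith))).tendsto
      rw [Real.zero_rpow (by linarith)] at this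
      exact this.mono_left nhdsWithin_le_nhds
    · exact tendsto_setIntegral_ball_zero hn hf
  rw [mul_zero, mul_zero, add_zero] at hlim
  have h0 : |(∫ y, U y * bilap φ y) - ∫ y, f y * φ y| ≤ 0 := by
    refine ge_of_tendsto hlim ?_
    filter_upwards [Ioc_mem_nhdsGT (zero_lt_one' ℝ)] with ε hε
    exact bound ε hε.1 hε.2
  exact sub_eq_zero.1 (abs_nonpos_iff.1 h0)

end WeakForm

section Representation

variable {n : ℕ} {U f : EuclideanSpace ℝ (Fin n) → ℝ}

/-- The rescaled error kernel: `Δ²` of `parametrix n ρ` is a Dirac mass plus this function. -/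
noncomputable def scaledErrKer (n : ℕ) (ρ : ℝ) (x : EuclideanSpace ℝ (Fin n)) : ℝ :=
  (ρ⁻¹) ^ n * errKer n (ρ⁻¹ • x)

lemma contDiff_scaledErrKer (ρ : ℝ) : ContDiff ℝ ∞ (scaledErrKer n ρ) :=
  contDiff_const.mul (contDiff_errKer.comp (contDiff_const_smul _))

lemma scaledErrKer_eq_zero {ρ : ℝ} (hρ : 0 < ρ) {x : EuclideanSpace ℝ (Fin n)}
    (hx : ρ / 2 < ‖x‖) : scaledErrKer n ρ x = 0 := by
  rw [scaledErrKer, errKer_eq_zero_of_lt, mul_zero]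
  rw [norm_inv_smul_eq hρ, lt_div_iff₀ hρ]
  linarith

lemma hasCompactSupport_scaledErrKer {ρ : ℝ} (hρ : 0 < ρ) :
    HasCompactSupport (scaledErrKer n ρ) := by
  refine HasCompactSupport.of_support_subset_isCompact (isCompact_closedBall 0 (ρ / 2)) fun x hx => ?_
  rw [mem_closedBall_zero_iff]
  by_contra! h
  exact hx (scaledErrKer_eq_zero hρ h)

lemma exists_abs_errKer_le : ∃ K, 0 ≤ K ∧ ∀ x : EuclideanSpace ℝ (Fin n), |errKer n x| ≤ K := by
  obtain ⟨K, hK⟩ := hasCompactSupport_errKer.exists_bound_of_continuous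
    (contDiff_errKer (n := n)).continuous
  exact ⟨K, (norm_nonneg _).trans (hK 0), hK⟩

lemma parametrix_mul_le {σ δ : ℝ} (hn : 5 ≤ n) (hδ : 0 < δ) {x : EuclideanSpace ℝ (Fin n)}
    {M : ℝ} (hf0 : ∀ y, 0 ≤ f y) (hM : ∀ y, ‖x - y‖ < δ → f y ≤ M)
    (y : EuclideanSpace ℝ (Fin n)) :
    parametrix n σ (x - y) * f y ≤ M * (ball (0 : EuclideanSpace ℝ (Fin n)) δ).indicator
      (fun z => ‖z‖ ^ (-(n - 4 : ℝ))) (x - y) + δ ^ (4 - n : ℝ) * f y := by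
  have hn' : (5 : ℝ) ≤ n := by exact_mod_cast hn
  have hP := parametrix_le σ (x - y)
  have hP0 := parametrix_nonneg σ (x - y)
  rcases lt_or_ge ‖x - y‖ δ with h | h
  · rw [Set.indicator_of_mem (by simpa using h), neg_sub]
    have h1 := mul_le_mul hP (hM y h) (hf0 y) (by positivity)
    have h2 := mul_nonneg (Real.rpow_nonneg hδ.le (4 - n : ℝ)) (hf0 y)
    linarith
  · rw [Set.indicator_of_notMem (by simpa using h), mul_zero, zero_add]
    exact mul_le_mul_of_nonneg_right
      (hP.trans (Real.rpow_le_rpow_of_nonpos hδ h (by linarith))) (hf0 y)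

lemma integrable_parametrix_mul {ρ δ : ℝ} (hn : 5 ≤ n) (hδ : 0 < δ) {x : EuclideanSpace ℝ (Fin n)}
    {M : ℝ} (hf : Integrable f) (hf0 : ∀ y, 0 ≤ f y) (hM : ∀ y, ‖x - y‖ < δ → f y ≤ M) :
    Integrable fun y => parametrix n ρ (x - y) * f y := by
  refine (((integrable_indicator_ball_sub_rpow (s := n - 4) (by omega) (by linarith) δ x).const_mul M).add
    (hf.const_mul (δ ^ (4 - n : ℝ)))).mono' ?_ (Eventually.of_forall fun y => ?_)
  · exact ((measurable_parametrix ρ).comp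
      (measurable_const.sub measurable_id)).aestronglyMeasurable.mul hf.aestronglyMeasurable
  · rw [Real.norm_of_nonneg (mul_nonneg (parametrix_nonneg _ _) (hf0 y))]
    exact parametrix_mul_le hn hδ hf0 hM y

lemma integral_parametrix_mul_le {σ : ℝ} (hn : 5 ≤ n) (hσ : 0 < σ)
    {x : EuclideanSpace ℝ (Fin n)} {M : ℝ} (hf0 : ∀ y, 0 ≤ f y)
    (hM : ∀ y, ‖x - y‖ < σ → f y ≤ M) :
    ∫ y, parametrix n σ (x - y) * f y ≤
      M * (σ ^ 4 * ∫ y in ball (0 : EuclideanSpace ℝ (Fin n)) 1, ‖y‖ ^ (-(n - 4 : ℝ))) := by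
  have e := integral_indicator_ball_sub_rpow (n - 4 : ℝ) hσ x
  rw [show (n - (n - 4) : ℝ) = (4 : ℕ) by norm_num, Real.rpow_natCast] at e
  rw [← e, ← integral_const_mul]
  refine integral_mono_of_nonneg (Eventually.of_forall fun y =>
    mul_nonneg (parametrix_nonneg _ _) (hf0 y))
    ((integrable_indicator_ball_sub_rpow (by omega) (by linarith) σ x).const_mul M)
    (Eventually.of_forall fun y => ?_)
  have hP := parametrix_le σ (x - y)
  rcases lt_or_ge ‖x - y‖ σ with h | h
  · simp only
    rw [Set.indicator_of_mem (by simpa using h), neg_sub, mul_comm]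
    exact mul_le_mul (hM y h) hP (parametrix_nonneg _ _) ((hf0 y).trans (hM y h))
  · simp only
    rw [Set.indicator_of_notMem (by simpa using h), parametrix_eq_zero hσ (by linarith)]
    simp

lemma exists_ball_le_of_continuousAt {g : EuclideanSpace ℝ (Fin n) → ℝ}
    {x : EuclideanSpace ℝ (Fin n)} (hg : ContinuousAt g x) :
    ∃ δ > 0, ∀ y, ‖x - y‖ < δ → g y ≤ g x + 1 := by
  obtain ⟨δ, hδ, h⟩ := Metric.continuousAt_iff.1 hg 1 one_pos
  refine ⟨δ, hδ, fun y hy => ?_⟩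
  have := h (x := y) (by rwa [dist_eq_norm, norm_sub_rev])
  rw [Real.dist_eq] at this
  linarith [le_abs_self (g y - g x)]

lemma tendsto_integral_mul_scaledErrKer {x : EuclideanSpace ℝ (Fin n)} (hU : Integrable U)
    (hU0 : ∀ y, 0 ≤ U y) (hx : ContinuousAt U x) :
    Tendsto (fun σ => ∫ y, U y * scaledErrKer n σ (x - y)) (𝓝[>] 0)
      (𝓝 (U x * ∫ z, errKer n z)) := by
  obtain ⟨δ, hδ, hM⟩ := exists_ball_le_of_continuousAt hx
  have heq (σ : ℝ) (hσ : 0 < σ) : ∫ y, U y * scaledErrKer n σ (x - y) =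
      ∫ z, U (x - σ • z) * errKer n z := by
    rw [← integral_scaled_mul hσ (errKer n) fun y => U (x - y),
      ← integral_sub_left_eq_self (fun y => U y * scaledErrKer n σ (x - y)) _ x]
    simp only [sub_sub_cancel, scaledErrKer]
  rw [← integral_const_mul]
  refine Tendsto.congr' (f₁ := fun σ => ∫ z, U (x - σ • z) * errKer n z) ?_ ?_
  · filter_upwards [self_mem_nhdsWithin] with σ hσ
    exact (heq σ hσ).symm
  · refine tendsto_integral_filter_of_dominated_convergence
      (fun z => (U x + 1) * ‖errKer n z‖) ?_ ?_ ?_ ?_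
    · filter_upwards [self_mem_nhdsWithin] with σ hσ
      refine AEStronglyMeasurable.mul ?_ contDiff_errKer.continuous.aestronglyMeasurable
      exact ((hU.comp_sub_left x).comp_smul (ne_of_gt hσ)).aestronglyMeasurable
    · filter_upwards [Ioo_mem_nhdsGT hδ] with σ hσ
      refine Eventually.of_forall fun z => ?_
      rw [norm_mul]
      by_cases hz : errKer n z = 0
      · simp [hz]
      have hz' := norm_le_of_errKer_ne_zero hz
      refine mul_le_mul_of_nonneg_right ?_ (norm_nonneg _)
      rw [Real.norm_of_nonneg (hU0 _)]
      apply hM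
      rw [sub_sub_cancel, norm_smul, Real.norm_of_nonneg hσ.1.le]
      nlinarith [hσ.1, hσ.2]
    · exact ((contDiff_errKer.continuous.integrable_of_hasCompactSupport
        hasCompactSupport_errKer).norm).const_mul _
    · refine Eventually.of_forall fun z => Tendsto.mul_const _ ?_
      have h1 : Tendsto (fun σ : ℝ => x - σ • z) (𝓝[>] 0) (𝓝 x) := by
        have : Continuous fun σ : ℝ => x - σ • z := by fun_prop
        have := this.tendsto 0
        simp only [zero_smul, sub_zero] at this
        exact this.mono_left nhdsWithin_le_nhds
      exact hx.tendsto.comp h1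

/-- Representation of a distributional solution by its right-hand side, up to a smooth error. -/
lemma IsWeakSol.representation (h : IsWeakSol U f) (hn : 5 ≤ n) {x : EuclideanSpace ℝ (Fin n)}
    {ρ : ℝ} (hx : x ≠ 0) (hρ : 0 < ρ) (hxρ : ‖x‖ + ρ / 2 < 1 / 2) :
    Integrable (fun y => parametrix n ρ (x - y) * f y) ∧
    (-∫ z, errKer n z) * U x =
      (∫ y, parametrix n ρ (x - y) * f y) - ∫ y, U y * scaledErrKer n ρ (x - y) := by
  have hx2 : ‖x‖ < 1 / 2 := by linarith
  obtain ⟨δ, hδ, hM⟩ := exists_ball_le_of_continuousAt (h.continuousAt_rhs x hx hx2)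
  have hi (σ : ℝ) := integrable_parametrix_mul (ρ := σ) hn hδ h.integrable_rhs h.nonneg_rhs hM
  refine ⟨hi ρ, ?_⟩
  have hi2 (σ : ℝ) (hσ : 0 < σ) : Integrable fun y => U y * scaledErrKer n σ (x - y) := by
    obtain ⟨K, hK⟩ := (hasCompactSupport_scaledErrKer (n := n) hσ).exists_bound_of_continuous
      (contDiff_scaledErrKer σ).continuous
    exact h.integrable.mul_bdd ((contDiff_scaledErrKer σ).continuous.comp
      (continuous_const.sub continuous_id)).aestronglyMeasurable
      (Eventually.of_forall fun y => hK (x - y))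
  have key (σ : ℝ) (hσ : 0 < σ) (hσρ : σ ≤ ρ) :
      (∫ y, U y * scaledErrKer n ρ (x - y)) - ∫ y, U y * scaledErrKer n σ (x - y) =
        (∫ y, parametrix n ρ (x - y) * f y) - ∫ y, parametrix n σ (x - y) * f y := by
    set φ0 : EuclideanSpace ℝ (Fin n) → ℝ := fun z => corrector n ρ z - corrector n σ z with hφ0
    have hφs : ContDiff ℝ ∞ φ0 := (contDiff_corrector hρ).sub (contDiff_corrector hσ)
    have hd : ContDiff ℝ ∞ fun y => φ0 (x - y) := hφs.comp (contDiff_const.sub contDiff_id)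
    have hs : tsupport (fun y => φ0 (x - y)) ⊆ ball 0 (1 / 2) := by
      refine (tsupport_comp_subset_preimage φ0 (f := fun y => x - y)
        (continuous_const.sub continuous_id)).trans fun y hy => ?_
      have hy := tsupport_corrector_sub_subset hσ hσρ hy
      rw [mem_closedBall_zero_iff] at hy
      rw [mem_ball_zero_iff]
      have : ‖y‖ ≤ ‖x‖ + ‖x - y‖ := by simpa using norm_sub_le x (x - y)
      linarith
    have hw := h.weak _ hd hs
    rw [bilap_comp_sub_left x (hφs.of_le (by norm_cast))] at hw
    rw [← integral_sub (hi2 ρ hρ) (hi2 σ hσ), ← integral_sub (hi ρ) (hi σ)]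
    convert hw using 3 with y y
    · simp only [hφ0]
      rw [bilap_sub ((contDiff_corrector hρ).contDiffAt.of_le (by norm_cast))
        ((contDiff_corrector hσ).contDiffAt.of_le (by norm_cast)), bilap_corrector hρ,
        bilap_corrector hσ, scaledErrKer, scaledErrKer]
      ring
    · simp only [hφ0, ← parametrix_sub]
      ring
  have lim1 := tendsto_integral_mul_scaledErrKer h.integrable h.nonneg (h.continuousAt x hx hx2)
  have lim2 : Tendsto (fun σ => ∫ y, parametrix n σ (x - y) * f y) (𝓝[>] 0) (𝓝 0) := by
    refine tendsto_of_tendsto_of_tendsto_of_le_of_le' tendsto_const_nhds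
      (h := fun σ : ℝ => (f x + 1) *
        (σ ^ 4 * ∫ y in ball (0 : EuclideanSpace ℝ (Fin n)) 1, ‖y‖ ^ (-(n - 4 : ℝ)))) ?_ ?_ ?_
    · have : Continuous fun σ : ℝ => (f x + 1) *
        (σ ^ 4 * ∫ y in ball (0 : EuclideanSpace ℝ (Fin n)) 1, ‖y‖ ^ (-(n - 4 : ℝ))) := by
        fun_prop
      have := this.tendsto 0
      simp only [ne_eq, OfNat.ofNat_ne_zero, not_false_eq_true, zero_pow, zero_mul, mul_zero] at this
      exact this.mono_left nhdsWithin_le_nhds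
    · exact Eventually.of_forall fun σ => integral_nonneg fun y =>
        mul_nonneg (parametrix_nonneg _ _) (h.nonneg_rhs y)
    · filter_upwards [Ioo_mem_nhdsGT hδ] with σ hσ
      exact integral_parametrix_mul_le hn hσ.1 h.nonneg_rhs fun y hy => hM y (hy.trans hσ.2)
  have lim := tendsto_nhds_unique
    (Tendsto.congr' ?_ ((tendsto_const_nhds (x := ∫ y, U y * scaledErrKer n ρ (x - y))).sub lim1))
    ((tendsto_const_nhds (x := ∫ y, parametrix n ρ (x - y) * f y)).sub lim2)
  · linarith
  · filter_upwards [Ioo_mem_nhdsGT hρ] with σ hσ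
    exact key σ hσ.1 hσ.2.le

end Representation

section EpsilonRegularity

variable {n : ℕ} {U f : EuclideanSpace ℝ (Fin n) → ℝ} {p q α : ℝ}

lemma abs_integral_mul_scaledErrKer_le {K t : ℝ} (hK : ∀ x, |errKer n x| ≤ K) (ht : 0 < t)
    (hU : Integrable U) (hU0 : ∀ y, 0 ≤ U y) (x : EuclideanSpace ℝ (Fin n)) :
    |∫ y, U y * scaledErrKer n t (x - y)| ≤ K * (t⁻¹) ^ n * ∫ y in ball x t, U y := by
  have s1 : ∫ y, U y * scaledErrKer n t (x - y) =
      ∫ y in ball x t, U y * scaledErrKer n t (x - y) := by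
    refine (setIntegral_eq_integral_of_forall_compl_eq_zero fun y hy => ?_).symm
    have : t ≤ ‖x - y‖ := by
      rw [mem_ball, not_lt, dist_comm, dist_eq_norm] at hy
      exact hy
    rw [scaledErrKer_eq_zero ht (by linarith), mul_zero]
  rw [s1, ← integral_const_mul, ← Real.norm_eq_abs]
  refine norm_integral_le_of_norm_le (hU.integrableOn.const_mul _) (Eventually.of_forall fun y => ?_)
  rw [norm_mul, Real.norm_of_nonneg (hU0 y), scaledErrKer, norm_mul,
    Real.norm_of_nonneg (by positivity), mul_comm, mul_comm K]
  exact mul_le_mul_of_nonneg_right (mul_le_mul_of_nonneg_left (hK _) (by positivity)) (hU0 y)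

lemma IsWeakSol.rpow_mul_le_aux (hn : 5 ≤ n) (hp : 1 < p) (hq : 1 < q) (hα0 : 0 < α)
    (hαp : α * p = α + 4) (hα : α * q = n) :
    ∃ C, 0 < C ∧ ∃ η₀, 0 < η₀ ∧ ∀ U f : EuclideanSpace ℝ (Fin n) → ℝ, IsWeakSol U f →
      (∀ y, f y = U y ^ p) → (Integrable fun y => U y ^ q) → ∀ η, 0 < η → η < η₀ →
      ∀ x, x ≠ 0 → ∀ σ, 0 < σ → ‖x‖ + σ / 2 < 1 / 2 →
      (∀ y, ‖x - y‖ < σ → U y ≤ 2 ^ α * U x) → ∫ y in ball x σ, U y ^ q ≤ η ^ q →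
      σ ^ α * U x ≤ C * η := by
  obtain ⟨K, hK0, hK⟩ := exists_abs_errKer_le (n := n)
  set c := -∫ z, errKer n z with hc
  have hc0 : 0 < c := by have := integral_errKer_neg hn; linarith
  set A := ∫ y in ball (0 : EuclideanSpace ℝ (Fin n)) 1, ‖y‖ ^ (-(n - 4 : ℝ)) with hA
  have hA0 : 0 ≤ A := integral_nonneg fun y => Real.rpow_nonneg (norm_nonneg _) _
  set V := volume.real (ball (0 : EuclideanSpace ℝ (Fin n)) 1) with hV
  have hV0 : 0 ≤ V := measureReal_nonneg
  set B := (2 ^ α) ^ p * A + 1 with hB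
  set D := K * (V + 1) + 1 with hD
  have hB0 : 0 < B := by positivity
  have hD0 : 0 < D := by positivity
  set τ₀ := (c / (2 * B)) ^ (1 / (p - 1)) with hτ₀
  have hτ₀0 : 0 < τ₀ := by positivity
  have hBτ (τ : ℝ) (hτ : 0 ≤ τ) (hle : τ ≤ τ₀) : B * τ ^ p ≤ c / 2 * τ := by
    have h1 : τ ^ (p - 1) ≤ c / (2 * B) := by
      calc τ ^ (p - 1) ≤ τ₀ ^ (p - 1) := Real.rpow_le_rpow hτ hle (by linarith)
        _ = _ := by
          rw [hτ₀, ← Real.rpow_mul (by positivity), one_div_mul_cancel (by linarith),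
            Real.rpow_one]
    have h2 : τ ^ p = τ ^ (p - 1) * τ := by
      rw [← Real.rpow_add_one' hτ (by linarith)]
      ring_nf
    rw [h2]
    calc B * (τ ^ (p - 1) * τ) ≤ B * (c / (2 * B) * τ) := by gcongr
      _ = _ := by field_simp
  refine ⟨2 * D / c, by positivity, c * τ₀ / (2 * D), by positivity, ?_⟩
  intro U f h hf hUq η hη hηlt x hx σ hσ hxσ hUle hE
  rcases (h.nonneg x).eq_or_lt' with hm | hm
  · rw [hm, mul_zero]; positivity
  set m := U x with hmdef
  have key (t : ℝ) (ht : 0 < t) (htσ : t ≤ σ) :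
      c * (t ^ α * m) ≤ B * (t ^ α * m) ^ p + D * η := by
    have hrep := (h.representation hn hx ht (by linarith)).2
    have h1 := integral_parametrix_mul_le hn ht (M := (2 ^ α * m) ^ p) h.nonneg_rhs
      fun y hy => by
        rw [hf y]
        exact Real.rpow_le_rpow (h.nonneg y) (hUle y (hy.trans_le htσ)) (by linarith)
    have h2 := abs_integral_mul_scaledErrKer_le hK ht h.integrable h.nonneg x
    have h3 := setIntegral_ball_le_of_rpow (x := x) hq hα hη ht h.nonneg h.integrable hUq
      ((setIntegral_mono_set hUq.integrableOn
        (Eventually.of_forall fun y => Real.rpow_nonneg (h.nonneg y) _)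
        (ball_subset_ball htσ).eventuallyLE).trans hE)
    have h4 : c * m ≤ (2 ^ α * m) ^ p * (t ^ 4 * A) +
        K * (t⁻¹) ^ n * ((V + 1) * (η * t ^ (n - α))) := by
      have := (neg_le_abs _).trans (h2.trans (mul_le_mul_of_nonneg_left h3 (by positivity)))
      linarith
    have e1 : t ^ α * ((2 ^ α * m) ^ p * (t ^ 4 * A)) = (2 ^ α) ^ p * A * (t ^ α * m) ^ p := by
      rw [Real.mul_rpow (by positivity) hm.le, Real.mul_rpow (by positivity) hm.le,
        ← Real.rpow_mul ht.le, hαp, Real.rpow_add ht,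
        show t ^ (4 : ℝ) = t ^ 4 by exact_mod_cast Real.rpow_natCast t 4]
      ring
    have e2 : t ^ α * (K * (t⁻¹) ^ n * ((V + 1) * (η * t ^ (n - α)))) = K * (V + 1) * η := by
      have : t ^ α * t ^ (n - α) * (t⁻¹) ^ n = 1 := by
        rw [← Real.rpow_add ht, add_sub_cancel, Real.rpow_natCast, ← mul_pow,
          mul_inv_cancel₀ ht.ne', one_pow]
      linear_combination K * (V + 1) * η * this
    have h5 := mul_le_mul_of_nonneg_left h4 (Real.rpow_nonneg ht.le α)
    rw [mul_add, e1, e2] at h5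
    have h6 : 0 ≤ (t ^ α * m) ^ p := by positivity
    rw [hB, hD]
    linarith
  have concl (τ : ℝ) (hτ : 0 < τ) (h1 : τ ≤ σ ^ α * m) (h2 : τ ≤ τ₀) : c / 2 * τ ≤ D * η := by
    have hk := key ((τ / m) ^ (1 / α)) (by positivity) (by
      have : τ / m ≤ σ ^ α := (div_le_iff₀ hm).2 h1
      calc (τ / m) ^ (1 / α) ≤ (σ ^ α) ^ (1 / α) := by gcongr
        _ = σ := by rw [← Real.rpow_mul hσ.le, mul_one_div_cancel hα0.ne', Real.rpow_one])
    rw [← Real.rpow_mul (by positivity), one_div_mul_cancel hα0.ne', Real.rpow_one,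
      div_mul_cancel₀ _ hm.ne'] at hk
    linarith [hBτ τ hτ.le h2]
  rcases le_total τ₀ (σ ^ α * m) with hle | hle
  · have := concl τ₀ hτ₀0 hle le_rfl
    rw [lt_div_iff₀ (by positivity)] at hηlt
    linarith
  · have := concl _ (by positivity) le_rfl hle
    rw [div_mul_eq_mul_div, le_div_iff₀ hc0]
    linarith

lemma exists_rpow_mul_le (hn : 5 ≤ n) (hp : 1 < p) (hq : 1 < q) (hα0 : 0 < α)
    (hαp : α * p = α + 4) (hα : α * q = n) (h : IsWeakSol U f) (hf : ∀ y, f y = U y ^ p)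
    (hUq : Integrable fun y => U y ^ q) {δ : ℝ} (hδ : 0 < δ) :
    ∃ r, 0 < r ∧ ∀ x, x ≠ 0 → ‖x‖ < r → ‖x‖ ^ α * U x ≤ δ := by
  obtain ⟨C, hC, η₀, hη₀, H⟩ := IsWeakSol.rpow_mul_le_aux hn hp hq hα0 hαp hα
  set η := min (η₀ / 2) (δ / (4 ^ α * C)) with hη
  have hη0 : 0 < η := lt_min (by positivity) (by positivity)
  have hη1 : η < η₀ := (min_le_left _ _).trans_lt (by linarith)
  have hη2 : 4 ^ α * C * η ≤ δ := by
    have := min_le_right (η₀ / 2) (δ / (4 ^ α * C))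
    rwa [← hη, le_div_iff₀ (by positivity), mul_comm] at this
  have hlim := tendsto_setIntegral_ball_zero (by omega) hUq
  have hev : ∀ᶠ ε in 𝓝[>] (0 : ℝ), ∫ y in ball (0 : EuclideanSpace ℝ (Fin n)) ε, U y ^ q < η ^ q :=
    hlim.eventually (gt_mem_nhds (by positivity))
  obtain ⟨ε, hεlt, hε0⟩ := (hev.and self_mem_nhdsWithin).exists
  have hε0 : 0 < ε := hε0
  refine ⟨min (ε / 2) (1 / 8), by positivity, fun x₀ hx₀ hx₀r => ?_⟩
  have hr1 : ‖x₀‖ < ε / 2 := hx₀r.trans_le (min_le_left _ _)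
  have hr2 : ‖x₀‖ < 1 / 8 := hx₀r.trans_le (min_le_right _ _)
  have hx0 : 0 < ‖x₀‖ := norm_pos_iff.2 hx₀
  rcases (h.nonneg x₀).eq_or_lt' with hm | hm
  · rw [hm, mul_zero]; exact hδ.le
  set ρ := ‖x₀‖ / 2 with hρ
  have hnorm (y) (hy : y ∈ closedBall x₀ ρ) : ρ ≤ ‖y‖ ∧ ‖y‖ ≤ 3 * ρ := by
    rw [mem_closedBall, dist_eq_norm] at hy
    have h1 := norm_sub_norm_le y x₀
    have h2 := norm_sub_norm_le x₀ y
    rw [norm_sub_rev] at h2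
    constructor <;> linarith
  have hne (y) (hy : y ∈ closedBall x₀ ρ) : y ≠ 0 := by
    rw [← norm_pos_iff]
    linarith [(hnorm y hy).1]
  have hcont : ContinuousOn (fun y => (ρ - ‖y - x₀‖) ^ α * U y) (closedBall x₀ ρ) := by
    intro y hy
    refine ContinuousAt.continuousWithinAt (ContinuousAt.mul ?_
      (h.continuousAt y (hne y hy) (by linarith [(hnorm y hy).2])))
    exact ContinuousAt.rpow_const (by fun_prop) (Or.inr hα0.le)
  obtain ⟨x₁, hx₁, hmax⟩ := (isCompact_closedBall x₀ ρ).exists_isMaxOn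
    ⟨x₀, mem_closedBall_self (by positivity)⟩ hcont
  have hmax (y) (hy : y ∈ closedBall x₀ ρ) :
      (ρ - ‖y - x₀‖) ^ α * U y ≤ (ρ - ‖x₁ - x₀‖) ^ α * U x₁ := hmax hy
  have hmax0 := hmax x₀ (mem_closedBall_self (by positivity))
  rw [sub_self, norm_zero, sub_zero] at hmax0
  set d := ρ - ‖x₁ - x₀‖ with hd
  have hd0 : 0 ≤ d := by
    rw [mem_closedBall, dist_eq_norm] at hx₁
    linarith
  have hdpos : 0 < d := by
    refine hd0.lt_of_ne' fun h0 => ?_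
    rw [h0, Real.zero_rpow hα0.ne', zero_mul] at hmax0
    have : 0 < ρ ^ α * U x₀ := by positivity
    linarith
  have hdρ : d ≤ ρ := by linarith [norm_nonneg (x₁ - x₀)]
  have hfin := H U f h hf hUq η hη0 hη1 x₁ (hne x₁ hx₁) (d / 2) (by positivity)
    (by linarith [(hnorm x₁ hx₁).2]) (fun y hy => by
      have htri : ‖y - x₀‖ ≤ ‖x₁ - y‖ + ‖x₁ - x₀‖ := by
        have := norm_sub_le_norm_sub_add_norm_sub y x₁ x₀
        rwa [norm_sub_rev y x₁] at this
      have hyb : y ∈ closedBall x₀ ρ := by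
        rw [mem_closedBall, dist_eq_norm]
        linarith
      have h1 := hmax y hyb
      have h2 : (d / 2) ^ α ≤ (ρ - ‖y - x₀‖) ^ α :=
        Real.rpow_le_rpow (by positivity) (by linarith) hα0.le
      have h3 := (mul_le_mul_of_nonneg_right h2 (h.nonneg y)).trans h1
      rw [Real.div_rpow hd0 (by norm_num), div_mul_eq_mul_div, div_le_iff₀ (by positivity)] at h3
      have h4 : 0 < d ^ α := by positivity
      nlinarith) (by
      refine (setIntegral_mono_set hUq.integrableOn
        (Eventually.of_forall fun y => Real.rpow_nonneg (h.nonneg y) _)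
        (LE.le.eventuallyLE fun y hy => ?_)).trans hεlt.le
      rw [mem_ball, dist_eq_norm] at hy
      rw [mem_ball_zero_iff]
      have := norm_sub_norm_le y x₁
      linarith [(hnorm x₁ hx₁).2])
  rw [Real.div_rpow hd0 (by norm_num), div_mul_eq_mul_div, div_le_iff₀ (by positivity)] at hfin
  have h1 : ‖x₀‖ ^ α = 2 ^ α * ρ ^ α := by
    rw [← Real.mul_rpow (by norm_num) (by positivity), hρ]
    congr 1
    ring
  have h4 : (4 : ℝ) ^ α = 2 ^ α * 2 ^ α := by
    rw [← Real.mul_rpow (by norm_num) (by norm_num)]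
    norm_num
  calc ‖x₀‖ ^ α * U x₀ = 2 ^ α * (ρ ^ α * U x₀) := by rw [h1]; ring
    _ ≤ 2 ^ α * (C * η * 2 ^ α) :=
        mul_le_mul_of_nonneg_left (hmax0.trans hfin) (by positivity)
    _ = 4 ^ α * C * η := by rw [h4]; ring
    _ ≤ δ := hη2

end EpsilonRegularity

section Bootstrap

variable {n : ℕ} {U f : EuclideanSpace ℝ (Fin n) → ℝ} {p q α : ℝ}

lemma IsWeakSol.exists_mul_le_integral_add (h : IsWeakSol U f) (hn : 5 ≤ n) {r : ℝ} (hr : 0 < r)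
    (hr4 : r ≤ 1 / 4) :
    ∃ M, 0 ≤ M ∧ ∀ x, x ≠ 0 → ‖x‖ < r / 2 → ∀ H : EuclideanSpace ℝ (Fin n) → ℝ, Integrable H →
      (∀ y, 0 ≤ H y) → (∀ y, ‖y‖ < r → ‖x - y‖ ^ (4 - n : ℝ) * f y ≤ H y) →
      (-∫ z, errKer n z) * U x ≤ (∫ y, H y) + M := by
  have hn' : (5 : ℝ) ≤ n := by exact_mod_cast hn
  obtain ⟨K, hK0, hK⟩ := exists_abs_errKer_le (n := n)
  have hfi : 0 ≤ ∫ y, f y := integral_nonneg h.nonneg_rhs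
  have hUi : 0 ≤ ∫ y, U y := integral_nonneg h.nonneg
  refine ⟨(r / 2) ^ (4 - n : ℝ) * (∫ y, f y) + K * ((1 / 4 : ℝ)⁻¹) ^ n * ∫ y, U y, by positivity,
    fun x hx hxr H hH hH0 hle => ?_⟩
  obtain ⟨hi, hrep⟩ := h.representation hn (ρ := 1 / 4) hx (by norm_num) (by linarith)
  have h1 := abs_integral_mul_scaledErrKer_le hK (t := 1 / 4) (by norm_num) h.integrable h.nonneg x
  have h2 : K * ((1 / 4 : ℝ)⁻¹) ^ n * ∫ y in ball x (1 / 4), U y ≤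
      K * ((1 / 4 : ℝ)⁻¹) ^ n * ∫ y, U y :=
    mul_le_mul_of_nonneg_left (setIntegral_le_integral h.integrable (Eventually.of_forall h.nonneg))
      (by positivity)
  have h3 : ∫ y, parametrix n (1 / 4) (x - y) * f y ≤
      ∫ y, (H y + (r / 2) ^ (4 - n : ℝ) * f y) := by
    refine integral_mono hi (hH.add (h.integrable_rhs.const_mul _)) fun y => ?_
    have hP := mul_le_mul_of_nonneg_right (parametrix_le (1 / 4) (x - y)) (h.nonneg_rhs y)
    refine hP.trans ?_
    have h0 : 0 ≤ (r / 2) ^ (4 - n : ℝ) * f y := mul_nonneg (by positivity) (h.nonneg_rhs y)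
    rcases lt_or_ge ‖y‖ r with hy | hy
    · exact (hle y hy).trans (le_add_of_nonneg_right h0)
    · have hxy : r / 2 ≤ ‖x - y‖ := by
        have := norm_sub_norm_le y x
        rw [norm_sub_rev] at this
        linarith
      exact (mul_le_mul_of_nonneg_right (Real.rpow_le_rpow_of_nonpos (by positivity) hxy
        (by linarith)) (h.nonneg_rhs y)).trans (le_add_of_nonneg_left (hH0 y))
  rw [integral_add hH (h.integrable_rhs.const_mul _), integral_const_mul] at h3
  have h4 := neg_le_abs (∫ y, U y * scaledErrKer n (1 / 4) (x - y))
  linarith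

lemma rpow_le_rpow_sub_one_mul {s t : ℝ} (hp : 1 < p) (hs : 0 ≤ s) (hst : s ≤ t) :
    s ^ p ≤ t ^ (p - 1) * s := by
  have h2 : s ^ p = s ^ (p - 1) * s := by
    rw [← Real.rpow_add_one' hs (by linarith)]
    ring_nf
  rw [h2]
  exact mul_le_mul_of_nonneg_right (Real.rpow_le_rpow hs hst (by linarith)) hs

lemma IsWeakSol.exists_le_mul_rpow (h : IsWeakSol U f) (hn : 5 ≤ n) (hp : 1 < p) (hq : 1 < q)
    (hα0 : 0 < α) (hα4 : α < n - 4) (hαp : α * p = α + 4) (hα : α * q = n)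
    (hf : ∀ y, f y = U y ^ p) (hU0 : U 0 = 0) (hUq : Integrable fun y => U y ^ q)
    {a : ℝ} (ha0 : 0 < a) (haα : a ≤ α) :
    ∃ r, 0 < r ∧ r ≤ 1 / 4 ∧ ∃ M, 0 ≤ M ∧ ∀ x, x ≠ 0 → ‖x‖ < r → U x ≤ M * ‖x‖ ^ (-a) := by
  have hn' : (5 : ℝ) ≤ n := by exact_mod_cast hn
  obtain ⟨C₁, hC₁0, hC₁⟩ := exists_integral_riesz_rpow_le hn hα0 hα4
  obtain ⟨C₂, hC₂0, hC₂⟩ := exists_integral_riesz_rpow_le hn ha0 (haα.trans_lt hα4)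
  set c := -∫ z, errKer n z with hc
  have hc0 : 0 < c := by have := integral_errKer_neg hn; linarith
  set θ := c / (2 * (C₁ + C₂ + 1)) with hθ
  have hθ0 : 0 < θ := by positivity
  have hθ1 : θ * C₁ ≤ c / 2 := by
    rw [hθ, div_mul_eq_mul_div, div_le_div_iff₀ (by positivity) (by positivity)]
    nlinarith
  have hθ2 : θ * C₂ ≤ c / 2 := by
    rw [hθ, div_mul_eq_mul_div, div_le_div_iff₀ (by positivity) (by positivity)]
    nlinarith
  set δ := θ ^ (1 / (p - 1)) with hδ
  have hδ0 : 0 < δ := by positivity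
  have hδp : δ ^ (p - 1) = θ := by
    rw [hδ, ← Real.rpow_mul hθ0.le, one_div_mul_cancel (by linarith), Real.rpow_one]
  obtain ⟨r₀, hr₀, hsmall⟩ := exists_rpow_mul_le hn hp hq hα0 hαp hα h hf hUq hδ0
  set r := min r₀ (1 / 4) with hr
  have hr0 : 0 < r := by positivity
  have hUδ (x : EuclideanSpace ℝ (Fin n)) (hx : x ≠ 0) (hxr : ‖x‖ < r) :
      U x ≤ δ * ‖x‖ ^ (-α) := by
    have := hsmall x hx (hxr.trans_le (min_le_left _ _))
    rw [Real.rpow_neg (norm_nonneg _), ← div_eq_mul_inv,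
      le_div_iff₀ (Real.rpow_pos_of_pos (norm_pos_iff.2 hx) _), mul_comm]
    exact this
  have hfθ (y : EuclideanSpace ℝ (Fin n)) (hy : y ≠ 0) (hyr : ‖y‖ < r) :
      f y ≤ θ * ‖y‖ ^ (-4 : ℝ) * U y := by
    rw [hf y]
    refine (rpow_le_rpow_sub_one_mul hp (h.nonneg y) (hUδ y hy hyr)).trans (le_of_eq ?_)
    rw [Real.mul_rpow hδ0.le (by positivity), hδp, ← Real.rpow_mul (norm_nonneg _)]
    congr 3
    linarith
  obtain ⟨M₀, hM₀, hmain⟩ := h.exists_mul_le_integral_add hn hr0 (min_le_right _ _)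
  set M := M₀ / c * r ^ a + δ * (r / 2) ^ (-α) * r ^ a with hM
  have hM0 : 0 ≤ M := by positivity
  have hra (x : EuclideanSpace ℝ (Fin n)) (hx : x ≠ 0) (hxr : ‖x‖ < r) :
      1 ≤ r ^ a * ‖x‖ ^ (-a) := by
    have hx0 : 0 < ‖x‖ := norm_pos_iff.2 hx
    rw [Real.rpow_neg hx0.le, ← div_eq_mul_inv, one_le_div (by positivity)]
    exact Real.rpow_le_rpow hx0.le hxr.le ha0.le
  have step (s : ℝ) (hs : 0 < s) (N : ℝ) (hN : 0 ≤ N)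
      (hUN : ∀ x, x ≠ 0 → ‖x‖ < r → U x ≤ N * (s * ‖x‖ ^ (-α) + ‖x‖ ^ (-a))) :
      ∀ x, x ≠ 0 → ‖x‖ < r → U x ≤ (M + N / 2) * (s * ‖x‖ ^ (-α) + ‖x‖ ^ (-a)) := by
    intro x hx hxr
    have hx0 : 0 < ‖x‖ := norm_pos_iff.2 hx
    have hw0 : 0 ≤ s * ‖x‖ ^ (-α) := by positivity
    have hra' := hra x hx hxr
    have hMw (m : ℝ) (hm : 0 ≤ m) : m ≤ m * r ^ a * (s * ‖x‖ ^ (-α) + ‖x‖ ^ (-a)) := by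
      have : m * 1 ≤ m * (r ^ a * (s * ‖x‖ ^ (-α) + ‖x‖ ^ (-a))) := by
        refine mul_le_mul_of_nonneg_left (hra'.trans ?_) hm
        gcongr
        linarith
      linarith
    have hNw : 0 ≤ N / 2 * (s * ‖x‖ ^ (-α) + ‖x‖ ^ (-a)) := by positivity
    have hM1 := hMw (M₀ / c) (by positivity)
    have hM2 := hMw (δ * (r / 2) ^ (-α)) (by positivity)
    have hM3 : M * (s * ‖x‖ ^ (-α) + ‖x‖ ^ (-a)) =
      M₀ / c * r ^ a * (s * ‖x‖ ^ (-α) + ‖x‖ ^ (-a)) +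
      δ * (r / 2) ^ (-α) * r ^ a * (s * ‖x‖ ^ (-α) + ‖x‖ ^ (-a)) := by rw [hM]; ring
    rw [add_mul, hM3]
    rcases lt_or_ge ‖x‖ (r / 2) with hxr2 | hxr2
    · obtain ⟨i1, b1⟩ := hC₁ x hx
      obtain ⟨i2, b2⟩ := hC₂ x hx
      have hHi : Integrable fun y => θ * N * (s * (‖x - y‖ ^ (4 - n : ℝ) * ‖y‖ ^ (-4 - α)) +
          ‖x - y‖ ^ (4 - n : ℝ) * ‖y‖ ^ (-4 - a)) := ((i1.const_mul s).add i2).const_mul _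
      have hb := hmain x hx hxr2 _ hHi (fun y => by positivity) (fun y hy => by
        rcases eq_or_ne y 0 with rfl | hy0
        · rw [hf, hU0, Real.zero_rpow (by linarith), mul_zero]
          positivity
        · have hy' : 0 < ‖y‖ := norm_pos_iff.2 hy0
          calc ‖x - y‖ ^ (4 - n : ℝ) * f y
              ≤ ‖x - y‖ ^ (4 - n : ℝ) * (θ * ‖y‖ ^ (-4 : ℝ) *
                (N * (s * ‖y‖ ^ (-α) + ‖y‖ ^ (-a)))) := by
                refine mul_le_mul_of_nonneg_left ((hfθ y hy0 hy).trans ?_) (by positivity)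
                exact mul_le_mul_of_nonneg_left (hUN y hy0 hy) (by positivity)
            _ = _ := by
                rw [sub_eq_add_neg (-4 : ℝ) α, sub_eq_add_neg (-4 : ℝ) a, Real.rpow_add hy',
                  Real.rpow_add hy']
                ring)
      rw [integral_const_mul, integral_add (i1.const_mul s) i2, integral_const_mul] at hb
      have hb2 : c * U x ≤ c / 2 * (N * (s * ‖x‖ ^ (-α) + ‖x‖ ^ (-a))) + M₀ := by
        have t1 : θ * N * (s * ∫ y, ‖x - y‖ ^ (4 - n : ℝ) * ‖y‖ ^ (-4 - α)) ≤
            c / 2 * (N * (s * ‖x‖ ^ (-α))) := by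
          calc _ ≤ θ * N * (s * (C₁ * ‖x‖ ^ (-α))) := by gcongr
            _ = θ * C₁ * (N * (s * ‖x‖ ^ (-α))) := by ring
            _ ≤ _ := by gcongr
        have t2 : θ * N * (∫ y, ‖x - y‖ ^ (4 - n : ℝ) * ‖y‖ ^ (-4 - a)) ≤
            c / 2 * (N * ‖x‖ ^ (-a)) := by
          calc _ ≤ θ * N * (C₂ * ‖x‖ ^ (-a)) := by gcongr
            _ = θ * C₂ * (N * ‖x‖ ^ (-a)) := by ring
            _ ≤ _ := by gcongr
        rw [mul_add] at hb
        linarith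
      have hb3 : U x ≤ N / 2 * (s * ‖x‖ ^ (-α) + ‖x‖ ^ (-a)) + M₀ / c := by
        have e : N / 2 * (s * ‖x‖ ^ (-α) + ‖x‖ ^ (-a)) + M₀ / c =
          (c / 2 * (N * (s * ‖x‖ ^ (-α) + ‖x‖ ^ (-a))) + M₀) / c := by field_simp
        rw [e, le_div_iff₀ hc0, mul_comm]
        exact hb2
      have : 0 ≤ δ * (r / 2) ^ (-α) := by positivity
      linarith
    · have h1 := hUδ x hx hxr
      have h2 : δ * ‖x‖ ^ (-α) ≤ δ * (r / 2) ^ (-α) :=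
        mul_le_mul_of_nonneg_left
          (Real.rpow_le_rpow_of_nonpos (by positivity) hxr2 (by linarith)) hδ0.le
      have : 0 ≤ M₀ / c := by positivity
      linarith
  have iter (s : ℝ) (hs : 0 < s) (k : ℕ) : ∀ x, x ≠ 0 → ‖x‖ < r →
      U x ≤ (2 * M + δ / s / 2 ^ k) * (s * ‖x‖ ^ (-α) + ‖x‖ ^ (-a)) := by
    induction k with
    | zero =>
      intro x hx hxr
      have hx0 : 0 < ‖x‖ := norm_pos_iff.2 hx
      calc U x ≤ δ * ‖x‖ ^ (-α) := hUδ x hx hxr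
        _ = δ / s / 2 ^ 0 * (s * ‖x‖ ^ (-α)) := by field_simp
        _ ≤ (2 * M + δ / s / 2 ^ 0) * (s * ‖x‖ ^ (-α) + ‖x‖ ^ (-a)) := by
          gcongr
          · linarith
          · exact le_add_of_nonneg_right (by positivity)
    | succ k ih =>
      have := step s hs _ (by positivity) ih
      convert this using 5
      rw [pow_succ]
      ring
  have lim1 (s : ℝ) (hs : 0 < s) (x) (hx : x ≠ 0) (hxr : ‖x‖ < r) :
      U x ≤ 2 * M * (s * ‖x‖ ^ (-α) + ‖x‖ ^ (-a)) := by
    have ht : Tendsto (fun k : ℕ => (2 * M + δ / s * (1 / 2) ^ k) *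
        (s * ‖x‖ ^ (-α) + ‖x‖ ^ (-a))) atTop
        (𝓝 ((2 * M + δ / s * 0) * (s * ‖x‖ ^ (-α) + ‖x‖ ^ (-a)))) :=
      (((tendsto_pow_atTop_nhds_zero_of_lt_one (by norm_num) (by norm_num)).const_mul _).const_add
        _).mul_const _
    rw [mul_zero, add_zero] at ht
    refine ge_of_tendsto' ht fun k => ?_
    have := iter s hs k x hx hxr
    rwa [div_eq_mul_one_div _ ((2 : ℝ) ^ k), ← one_div_pow] at this
  refine ⟨r, hr0, min_le_right _ _, 2 * M, by positivity, fun x hx hxr => ?_⟩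
  have ht : Tendsto (fun s : ℝ => 2 * M * (s * ‖x‖ ^ (-α) + ‖x‖ ^ (-a))) (𝓝[>] 0)
      (𝓝 (2 * M * (0 * ‖x‖ ^ (-α) + ‖x‖ ^ (-a)))) := by
    have : Continuous fun s : ℝ => 2 * M * (s * ‖x‖ ^ (-α) + ‖x‖ ^ (-a)) := by fun_prop
    exact (this.tendsto 0).mono_left nhdsWithin_le_nhds
  rw [zero_mul, zero_add] at ht
  refine ge_of_tendsto ht ?_
  filter_upwards [self_mem_nhdsWithin] with s hs
  exact lim1 s hs x hx hxr

lemma IsWeakSol.exists_bound (h : IsWeakSol U f) (hn : 5 ≤ n) (hp : 1 < p) (hq : 1 < q)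
    (hα0 : 0 < α) (hα4 : α < n - 4) (hαp : α * p = α + 4) (hα : α * q = n)
    (hf : ∀ y, f y = U y ^ p) (hU0 : U 0 = 0) (hUq : Integrable fun y => U y ^ q) :
    ∃ r, 0 < r ∧ r ≤ 1 / 4 ∧ ∃ M, 0 ≤ M ∧ ∀ x, ‖x‖ < r → U x ≤ M := by
  have hn' : (5 : ℝ) ≤ n := by exact_mod_cast hn
  set a := min α (2 / p) with ha
  have ha0 : 0 < a := by positivity
  obtain ⟨r, hr0, hr4, M, hM0, hM⟩ := h.exists_le_mul_rpow hn hp hq hα0 hα4 hαp hα hf hU0 hUq ha0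
    (min_le_left _ _)
  set b := a * p with hb
  have hb0 : 0 < b := by positivity
  have hb2 : b ≤ 2 := by
    have : a ≤ 2 / p := min_le_right _ _
    rwa [le_div_iff₀ (by linarith)] at this
  set c := -∫ z, errKer n z with hc
  have hc0 : 0 < c := by have := integral_errKer_neg hn; linarith
  obtain ⟨M₀, hM₀, hmain⟩ := h.exists_mul_le_integral_add hn hr0 hr4
  set D := (2 * r) ^ (n - (n - 4 + b)) *
    ∫ y in ball (0 : EuclideanSpace ℝ (Fin n)) 1, ‖y‖ ^ (-(n - 4 + b)) with hD
  have hD0 : 0 ≤ D := mul_nonneg (by positivity)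
    (integral_nonneg fun y => Real.rpow_nonneg (norm_nonneg _) _)
  refine ⟨r / 2, by positivity, by linarith, (M ^ p * (D + D) + M₀) / c, by positivity,
    fun x hxr => ?_⟩
  rcases eq_or_ne x 0 with rfl | hx
  · rw [hU0]; positivity
  set g : EuclideanSpace ℝ (Fin n) → ℝ :=
    (ball (0 : EuclideanSpace ℝ (Fin n)) (2 * r)).indicator fun z => ‖z‖ ^ (-(n - 4 + b)) with hg
  have hg0 (y) : 0 ≤ g y := Set.indicator_nonneg (fun z _ => Real.rpow_nonneg (norm_nonneg _) _) _
  have i1 : Integrable fun y => g (x - y) :=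
    integrable_indicator_ball_sub_rpow (by omega) (by linarith) _ _
  have i2 : Integrable fun y => g (0 - y) :=
    integrable_indicator_ball_sub_rpow (by omega) (by linarith) _ _
  have hb := hmain x hx hxr (fun y => M ^ p * (g (x - y) + g (0 - y)))
    ((i1.add i2).const_mul _) (fun y => mul_nonneg (by positivity) (add_nonneg (hg0 _) (hg0 _)))
    (fun y hy => by
      rcases eq_or_ne y 0 with rfl | hy0
      · rw [hf, hU0, Real.zero_rpow (by linarith), mul_zero]
        exact mul_nonneg (by positivity) (add_nonneg (hg0 _) (hg0 _))
      have hxy : ‖x - y‖ < 2 * r := by linarith [norm_sub_le x y]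
      rw [hg, Set.indicator_of_mem (by simpa using hxy),
        Set.indicator_of_mem (by rw [zero_sub, mem_ball_zero_iff, norm_neg]; linarith),
        zero_sub, norm_neg]
      have h1 : f y ≤ M ^ p * ‖y‖ ^ (-b) := by
        rw [hf]
        refine (Real.rpow_le_rpow (h.nonneg y) (hM y hy0 hy) (by linarith)).trans (le_of_eq ?_)
        rw [Real.mul_rpow hM0 (by positivity), ← Real.rpow_mul (norm_nonneg _), neg_mul]
      calc _ ≤ ‖x - y‖ ^ (4 - n : ℝ) * (M ^ p * ‖y‖ ^ (-b)) := by gcongr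
        _ = M ^ p * (‖x - y‖ ^ (4 - n : ℝ) * ‖y‖ ^ (-b)) := by ring
        _ ≤ _ := by
          gcongr
          exact riesz_mul_rpow_le hb0 hn x y)
  rw [integral_const_mul, integral_add i1 i2,
    integral_indicator_ball_sub_rpow _ (by positivity),
    integral_indicator_ball_sub_rpow _ (by positivity)] at hb
  rw [le_div_iff₀ hc0, mul_comm]
  exact hb

end Bootstrap

section Regularity

variable {n : ℕ}

lemma norm_convolution_le {E F G : Type*} [NormedAddCommGroup E] [NormedSpace ℝ E]
    [NormedAddCommGroup F] [NormedSpace ℝ F] [NormedAddCommGroup G] [NormedSpace ℝ G]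
    (L : E →L[ℝ] F →L[ℝ] G) {φ : EuclideanSpace ℝ (Fin n) → E} {g : EuclideanSpace ℝ (Fin n) → F}
    {M : ℝ} (hφ : Integrable φ) (hg : ∀ y, ‖g y‖ ≤ M) (x : EuclideanSpace ℝ (Fin n)) :
    ‖(φ ⋆[L] g) x‖ ≤ ‖L‖ * (∫ y, ‖φ y‖) * M := by
  refine (norm_integral_le_of_norm_le ((hφ.norm.const_mul ‖L‖).mul_const M)
    (Eventually.of_forall fun t => ?_)).trans (le_of_eq ?_)
  · refine (L.le_opNorm₂ _ _).trans ?_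
    gcongr
    exact hg _
  · rw [integral_mul_const, integral_const_mul]

lemma norm_iteratedFDeriv_convolution_le {F : Type} [NormedAddCommGroup F] [NormedSpace ℝ F]
    {g : EuclideanSpace ℝ (Fin n) → F} {M : ℝ} (hM : 0 ≤ M)
    (hgi : LocallyIntegrable g) (hg : ∀ y, ‖g y‖ ≤ M) (k : ℕ) :
    ∀ {E G : Type} [NormedAddCommGroup E] [NormedSpace ℝ E] [NormedAddCommGroup G]
      [NormedSpace ℝ G] (L : E →L[ℝ] F →L[ℝ] G) {φ : EuclideanSpace ℝ (Fin n) → E},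
      HasCompactSupport φ → ContDiff ℝ ∞ φ → ∀ x,
      ‖iteratedFDeriv ℝ k (φ ⋆[L] g) x‖ ≤ ‖L‖ * (∫ y, ‖iteratedFDeriv ℝ k φ y‖) * M := by
  induction k with
  | zero =>
    intro E G _ _ _ _ L φ hc hφ x
    simp only [norm_iteratedFDeriv_zero]
    exact norm_convolution_le L (hφ.continuous.integrable_of_hasCompactSupport hc) hg x
  | succ k ih =>
    intro E G _ _ _ _ L φ hc hφ x
    have hd : fderiv ℝ (φ ⋆[L] g) =
        (fderiv ℝ φ ⋆[L.precompL (EuclideanSpace ℝ (Fin n))] g) := by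
      ext1 z
      exact (hc.hasFDerivAt_convolution_left L (hφ.of_le (by norm_cast)) hgi z).fderiv
    rw [← norm_iteratedFDeriv_fderiv, hd]
    refine (ih _ (hc.fderiv (𝕜 := ℝ)) (hφ.fderiv_right (by norm_cast)) x).trans ?_
    simp only [norm_iteratedFDeriv_fderiv]
    gcongr
    exact L.norm_precompL_le _

lemma integrable_parametrix (hn : 5 ≤ n) {ρ : ℝ} (hρ : 0 < ρ) : Integrable (parametrix n ρ) := by
  have hn' : (5 : ℝ) ≤ n := by exact_mod_cast hn
  have h := ((integrableOn_ball_norm_rpow (n := n) (by omega) (s := n - 4) (by linarith) ρ)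
    ).integrable_indicator measurableSet_ball
  refine h.mono' (measurable_parametrix ρ).aestronglyMeasurable (Eventually.of_forall fun y => ?_)
  rw [Real.norm_of_nonneg (parametrix_nonneg _ _)]
  rcases lt_or_ge ‖y‖ ρ with hy | hy
  · rw [Set.indicator_of_mem (by simpa using hy), neg_sub]
    exact parametrix_le _ _
  · rw [parametrix_eq_zero hρ (by linarith)]
    exact Set.indicator_nonneg (fun z _ => Real.rpow_nonneg (norm_nonneg _) _) _

lemma integral_norm_parametrix_le (hn : 5 ≤ n) {ρ : ℝ} (hρ : 0 < ρ) :
    ∫ y, ‖parametrix n ρ y‖ ≤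
      ρ ^ 4 * ∫ y in ball (0 : EuclideanSpace ℝ (Fin n)) 1, ‖y‖ ^ (-(n - 4 : ℝ)) := by
  have h := integral_parametrix_mul_le hn hρ (x := 0) (M := 1) (f := fun _ => 1)
    (fun _ => zero_le_one) (fun _ _ => le_rfl)
  simp only [mul_one, one_mul] at h
  rw [integral_sub_left_eq_self (fun y => parametrix n ρ y)] at h
  simpa only [Real.norm_of_nonneg (parametrix_nonneg _ _)] using h

lemma integral_norm_iteratedFDeriv_corrector_sub {ρ t : ℝ} (hρ : 0 < ρ) (ht : 0 < t)
    (k : ℕ) :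
    ∫ y, ‖iteratedFDeriv ℝ k
      (fun x => corrector n (t * ρ) x - corrector n (t * ρ / 2) x) y‖ =
    t ^ (4 - k : ℝ) * ∫ y, ‖iteratedFDeriv ℝ k
      (fun x => corrector n ρ x - corrector n (ρ / 2) x) y‖ := by
  set ψ : EuclideanSpace ℝ (Fin n) → ℝ := fun x => corrector n ρ x - corrector n (ρ / 2) x with hψ
  have hψd : ContDiff ℝ ∞ ψ := (contDiff_corrector hρ).sub (contDiff_corrector (by positivity))
  have key (x : EuclideanSpace ℝ (Fin n)) (σ : ℝ) (hσ : 0 < σ) :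
      corrector n (t * σ) x = t ^ (4 - n : ℝ) * corrector n σ (t⁻¹ • x) := by
    rw [corrector_eq (mul_pos ht hσ), corrector_eq hσ, smul_smul, mul_inv, mul_comm t⁻¹,
      Real.mul_rpow ht.le hσ.le, mul_assoc]
  have h1 : (fun x : EuclideanSpace ℝ (Fin n) =>
      corrector n (t * ρ) x - corrector n (t * ρ / 2) x) =
      fun x => t ^ (4 - n : ℝ) • ψ (t⁻¹ • x) := by
    ext x
    rw [mul_div_assoc, key x ρ hρ, key x (ρ / 2) (by positivity), smul_eq_mul, hψ]
    ring
  have h2 (y : EuclideanSpace ℝ (Fin n)) : ‖iteratedFDeriv ℝ k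
      (fun x => corrector n (t * ρ) x - corrector n (t * ρ / 2) x) y‖ =
      t ^ (4 - n : ℝ) * (t⁻¹ ^ k * ‖iteratedFDeriv ℝ k ψ (t⁻¹ • y)‖) := by
    have hd : ContDiff ℝ k ψ := hψd.of_le (by exact_mod_cast le_top)
    have hd' : ContDiff ℝ k fun x => ψ (t⁻¹ • x) := hd.comp (contDiff_const_smul _)
    rw [h1, iteratedFDeriv_const_smul_apply' hd'.contDiffAt,
      iteratedFDeriv_comp_const_smul _ hd, norm_smul, norm_smul,
      Real.norm_of_nonneg (by positivity), Real.norm_of_nonneg (by positivity)]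
  simp_rw [h2]
  rw [integral_const_mul, integral_const_mul,
    Measure.integral_comp_smul volume (fun y => ‖iteratedFDeriv ℝ k ψ y‖)]
  rw [finrank_euclideanSpace, Fintype.card_fin, abs_of_nonneg (by positivity), smul_eq_mul,
    ← mul_assoc, ← mul_assoc]
  congr 1
  rw [inv_pow, inv_pow, inv_inv, ← Real.rpow_natCast, ← Real.rpow_natCast,
    ← Real.rpow_neg ht.le, ← Real.rpow_add ht, ← Real.rpow_add ht]
  congr 1
  ring

/-- The potential of a bounded function with kernel `parametrix` gains three derivatives. -/
lemma contDiff_three_parametrix_convolution {F : Type} [NormedAddCommGroup F] [NormedSpace ℝ F]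
    [CompleteSpace F] (hn : 5 ≤ n) {ρ : ℝ} (hρ : 0 < ρ) {g : EuclideanSpace ℝ (Fin n) → F} {M : ℝ}
    (hgm : AEStronglyMeasurable g) (hg : ∀ y, ‖g y‖ ≤ M) :
    ContDiff ℝ 3 (parametrix n ρ ⋆[ContinuousLinearMap.lsmul ℝ ℝ] g) := by
  have hM : 0 ≤ M := (norm_nonneg _).trans (hg 0)
  have hgi : LocallyIntegrable g :=
    (locallyIntegrable_const M).mono hgm (Eventually.of_forall fun y => by
      rw [Real.norm_of_nonneg hM]; exact hg y)
  set L : ℝ →L[ℝ] F →L[ℝ] F := ContinuousLinearMap.lsmul ℝ ℝ with hL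
  set s : ℕ → ℝ := fun j => (1 / 2 : ℝ) ^ j * ρ with hs
  have hs0 (j) : 0 < s j := by positivity
  have hs1 (j) : s (j + 1) = s j / 2 := by simp only [hs, pow_succ]; ring
  have hs2 (j) : s (j + 1) ≤ s j := by rw [hs1]; linarith [hs0 j]
  set φ : ℕ → EuclideanSpace ℝ (Fin n) → ℝ :=
    fun j x => corrector n (s j) x - corrector n (s (j + 1)) x with hφ
  have hφc (j) : HasCompactSupport (φ j) := hasCompactSupport_corrector_sub (hs0 _) (hs2 j)
  have hφd (j) : ContDiff ℝ ∞ (φ j) := (contDiff_corrector (hs0 _)).sub (contDiff_corrector (hs0 _))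
  set C : ℕ → ℝ := fun k => ∫ y, ‖iteratedFDeriv ℝ k
      (fun x : EuclideanSpace ℝ (Fin n) => corrector n ρ x - corrector n (ρ / 2) x) y‖ with hC
  have hC0 (k) : 0 ≤ C k := integral_nonneg fun y => norm_nonneg _
  have hbd (k j : ℕ) (hk : k ≤ 3) (x) :
      ‖iteratedFDeriv ℝ k (φ j ⋆[L] g) x‖ ≤ (1 / 2 : ℝ) ^ j * (‖L‖ * C k * M) := by
    refine (norm_iteratedFDeriv_convolution_le hM hgi hg k L (hφc j) (hφd j) x).trans ?_
    have e : ∫ y, ‖iteratedFDeriv ℝ k (φ j) y‖ = ((1 / 2 : ℝ) ^ j) ^ (4 - k : ℝ) * C k := by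
      simp only [hφ, hs1]
      exact integral_norm_iteratedFDeriv_corrector_sub hρ (by positivity) k
    have hk' : (k : ℝ) ≤ 3 := by exact_mod_cast hk
    have e2 : ((1 / 2 : ℝ) ^ j) ^ (4 - k : ℝ) ≤ (1 / 2 : ℝ) ^ j := by
      calc ((1 / 2 : ℝ) ^ j) ^ (4 - k : ℝ) ≤ ((1 / 2 : ℝ) ^ j) ^ (1 : ℝ) :=
            Real.rpow_le_rpow_of_exponent_ge (by positivity)
              (pow_le_one₀ (by norm_num) (by norm_num)) (by linarith)
        _ = _ := Real.rpow_one _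
    rw [e]
    calc ‖L‖ * (((1 / 2 : ℝ) ^ j) ^ (4 - k : ℝ) * C k) * M
        = ((1 / 2 : ℝ) ^ j) ^ (4 - k : ℝ) * (‖L‖ * C k * M) := by ring
      _ ≤ _ := by have := hC0 k; gcongr
  have hgeo (c : ℝ) : Summable fun j : ℕ => (1 / 2 : ℝ) ^ j * c :=
    (summable_geometric_of_lt_one (by norm_num) (by norm_num)).mul_right c
  have hsmooth : ContDiff ℝ ((3 : ℕ∞) : ℕ∞ω) fun x => ∑' j, (φ j ⋆[L] g) x :=
    contDiff_tsum (v := fun k j => (1 / 2 : ℝ) ^ j * (‖L‖ * C k * M))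
      (fun j => ((hφc j).contDiff_convolution_left L (hφd j) hgi).of_le (by exact_mod_cast le_top))
      (fun k _ => hgeo _) (fun k j x hk => hbd k j (by exact_mod_cast hk) x)
  have hex (σ : ℝ) (hσ : 0 < σ) (x) : ConvolutionExistsAt (parametrix n σ) g x L :=
    ((integrable_parametrix hn hσ).norm.mul_const M).mono'
      (AEStronglyMeasurable.convolution_integrand_snd _
        (measurable_parametrix σ).aestronglyMeasurable hgm _) (Eventually.of_forall fun t => by
        rw [hL, ContinuousLinearMap.lsmul_apply, norm_smul]
        gcongr
        exact hg _)
  have hpart (x) (m : ℕ) : ∑ j ∈ Finset.range m, (φ j ⋆[L] g) x =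
      (parametrix n ρ ⋆[L] g) x - (parametrix n (s m) ⋆[L] g) x := by
    have hj (j) : (φ j ⋆[L] g) x =
        (parametrix n (s j) ⋆[L] g) x - (parametrix n (s (j + 1)) ⋆[L] g) x := by
      simp only [convolution]
      rw [← integral_sub (hex _ (hs0 _) x) (hex _ (hs0 _) x)]
      refine integral_congr_ae (Eventually.of_forall fun t => ?_)
      simp only [hφ, ← parametrix_sub, hL, ContinuousLinearMap.lsmul_apply, sub_smul]
    simp_rw [hj]
    rw [Finset.sum_range_sub' (fun j => (parametrix n (s j) ⋆[L] g) x)]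
    simp [hs]
  have htsum (x) : ∑' j, (φ j ⋆[L] g) x = (parametrix n ρ ⋆[L] g) x := by
    have hsum : Summable fun j => (φ j ⋆[L] g) x :=
      Summable.of_norm_bounded (hgeo _) fun j => by
        have := hbd 0 j (by norm_num) x
        rwa [norm_iteratedFDeriv_zero] at this
    refine tendsto_nhds_unique hsum.hasSum.tendsto_sum_nat ?_
    simp_rw [hpart x]
    suffices h : Tendsto (fun m => (parametrix n (s m) ⋆[L] g) x) atTop (𝓝 0) by
      simpa using h.const_sub ((parametrix n ρ ⋆[L] g) x)
    set I := ∫ y in ball (0 : EuclideanSpace ℝ (Fin n)) 1, ‖y‖ ^ (-(n - 4 : ℝ)) with hI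
    have hst : Tendsto s atTop (𝓝 0) := by
      simpa [hs] using (tendsto_pow_atTop_nhds_zero_of_lt_one (r := (1 / 2 : ℝ)) (by norm_num)
        (by norm_num)).mul_const ρ
    have hlim : Tendsto (fun m => ‖L‖ * ((s m) ^ 4 * I) * M) atTop (𝓝 0) := by
      simpa using (((hst.pow 4).mul_const I).const_mul ‖L‖).mul_const M
    refine squeeze_zero_norm (fun m => ?_) hlim
    refine (norm_convolution_le L (integrable_parametrix hn (hs0 m)) hg x).trans ?_
    gcongr
    exact integral_norm_parametrix_le hn (hs0 m)
  simp only [htsum] at hsmooth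
  exact_mod_cast hsmooth

lemma contDiff_four_parametrix_convolution (hn : 5 ≤ n) {ρ : ℝ} (hρ : 0 < ρ)
    {g : EuclideanSpace ℝ (Fin n) → ℝ} (hgc : HasCompactSupport g) (hg : ContDiff ℝ 1 g) :
    ContDiff ℝ 4 (parametrix n ρ ⋆[ContinuousLinearMap.lsmul ℝ ℝ] g) := by
  have hd := hgc.hasFDerivAt_convolution_right (ContinuousLinearMap.lsmul ℝ ℝ : ℝ →L[ℝ] ℝ →L[ℝ] ℝ)
    (integrable_parametrix hn hρ).locallyIntegrable hg
  have h34 : (4 : ℕ∞ω) = 3 + 1 := by norm_num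
  rw [h34, contDiff_succ_iff_fderiv]
  refine ⟨fun x => (hd x).differentiableAt, by simp, ?_⟩
  have hcont : Continuous (fderiv ℝ g) := hg.continuous_fderiv (by norm_num)
  obtain ⟨M, hM⟩ := (hgc.fderiv (𝕜 := ℝ)).exists_bound_of_continuous hcont
  have h3 := contDiff_three_parametrix_convolution hn hρ hcont.aestronglyMeasurable hM
  convert h3 using 1
  ext1 x
  rw [(hd x).fderiv]
  simp only [convolution]
  congr 1

variable {U f : EuclideanSpace ℝ (Fin n) → ℝ} {p : ℝ}

lemma IsWeakSol.exists_contDiff_of_parametrix (h : IsWeakSol U f) (hn : 5 ≤ n) {r : ℝ}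
    (hr : 0 < r) (hr4 : r ≤ 1 / 4) {g : EuclideanSpace ℝ (Fin n) → ℝ}
    (hgf : ∀ y, y ≠ 0 → ‖y‖ < r → g y = f y) {m : ℕ}
    (hg : ContDiff ℝ m (parametrix n r ⋆[ContinuousLinearMap.lsmul ℝ ℝ] g)) :
    ∃ V : EuclideanSpace ℝ (Fin n) → ℝ, ContDiff ℝ m V ∧ ∀ x, x ≠ 0 → ‖x‖ < r / 2 → U x = V x := by
  have hc0 := integral_errKer_neg hn
  have : NeZero n := ⟨by omega⟩
  have hκ : ContDiff ℝ m (scaledErrKer n r ⋆[ContinuousLinearMap.lsmul ℝ ℝ] U) :=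
    ((hasCompactSupport_scaledErrKer hr).contDiff_convolution_left _ (contDiff_scaledErrKer r)
      h.integrable.locallyIntegrable).of_le (by exact_mod_cast le_top)
  refine ⟨fun x => (-∫ z, errKer n z)⁻¹ *
    ((parametrix n r ⋆[ContinuousLinearMap.lsmul ℝ ℝ] g) x -
      (scaledErrKer n r ⋆[ContinuousLinearMap.lsmul ℝ ℝ] U) x),
    contDiff_const.mul (hg.sub hκ), fun x hx hxr => ?_⟩
  obtain ⟨-, hrep⟩ := h.representation hn hx hr (by linarith)
  rw [eq_inv_mul_iff_mul_eq₀ (by linarith), hrep, convolution_eq_swap, convolution_eq_swap]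
  congr 1
  · have hne : ∀ᵐ y : EuclideanSpace ℝ (Fin n), y ≠ 0 := by
      have : Nontrivial (EuclideanSpace ℝ (Fin n)) := inferInstance
      simp [ae_iff, measure_singleton]
    refine integral_congr_ae (hne.mono fun y hy => ?_)
    simp only [ContinuousLinearMap.lsmul_apply, smul_eq_mul]
    rcases lt_or_ge ‖y‖ r with hyr | hyr
    · rw [hgf y hy hyr]
    · rw [parametrix_eq_zero hr, zero_mul, zero_mul]
      have := norm_sub_norm_le y x
      rw [norm_sub_rev] at this
      linarith
  · simp only [ContinuousLinearMap.lsmul_apply, smul_eq_mul, mul_comm]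

lemma IsWeakSol.exists_contDiff_four (h : IsWeakSol U f) (hn : 5 ≤ n) (hp : 1 < p)
    (hf : ∀ y, f y = U y ^ p) {r M : ℝ} (hr : 0 < r) (hr4 : r ≤ 1 / 4)
    (hM : ∀ x, ‖x‖ < r → U x ≤ M) :
    ∃ V : EuclideanSpace ℝ (Fin n) → ℝ, ContDiff ℝ 4 V ∧
      ∃ r', 0 < r' ∧ ∀ x, x ≠ 0 → ‖x‖ < r' → U x = V x := by
  have hM0 : 0 ≤ M := (h.nonneg 0).trans (hM 0 (by simpa using hr))
  have h3 := contDiff_three_parametrix_convolution hn hr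
    (g := (ball 0 r).indicator f) (M := M ^ p)
    (h.integrable_rhs.indicator measurableSet_ball).aestronglyMeasurable fun y => by
      by_cases hy : y ∈ ball 0 r
      · rw [Set.indicator_of_mem hy]
        rw [Real.norm_of_nonneg (h.nonneg_rhs y), hf]
        exact Real.rpow_le_rpow (h.nonneg y) (hM y (by simpa using hy)) (by linarith)
      · rw [Set.indicator_of_notMem hy, norm_zero]; positivity
  obtain ⟨V, hV, hUV⟩ := h.exists_contDiff_of_parametrix hn hr hr4 (m := 3)
    (fun y _ hy => Set.indicator_of_mem (s := ball 0 r) (by simpa using hy) f) (by exact_mod_cast h3)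
  set g : EuclideanSpace ℝ (Fin n) → ℝ := fun y => cutoff n ((2 * r)⁻¹ • y) * ‖V y‖ ^ p with hg
  have hg1 : ContDiff ℝ 1 g := ((contDiff_cutoff_smul (2 * r)).of_le (by norm_cast)).mul
    ((hV.of_le (by norm_cast)).norm_rpow hp)
  have hgc : HasCompactSupport g :=
    HasCompactSupport.of_support_subset_isCompact (isCompact_closedBall 0 r) fun x hx => by
      rw [mem_closedBall_zero_iff]
      by_contra! hlt
      refine hx ?_
      rw [hg]
      simp only
      rw [cutoff_eq_zero, zero_mul]
      rw [norm_inv_smul_eq (by positivity), le_div_iff₀ (by positivity)]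
      linarith
  obtain ⟨W, hW, hUW⟩ := h.exists_contDiff_of_parametrix hn (r := r / 2) (by positivity)
    (by linarith) (m := 4) (g := g) (fun y hy hyr => by
      rw [hg]
      simp only
      rw [cutoff_eq_one, one_mul, ← hUV y hy hyr, Real.norm_of_nonneg (h.nonneg y), hf]
      rw [norm_inv_smul_eq (by positivity), div_le_iff₀ (by positivity)]
      linarith)
    (by exact_mod_cast contDiff_four_parametrix_convolution hn (by positivity) hgc hg1)
  exact ⟨W, by exact_mod_cast hW, r / 2 / 2, by positivity, hUW⟩

end Regularity

section Removability

variable {n : ℕ}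

lemma rpow_le_one_add_rpow {t a b : ℝ} (ht : 0 ≤ t) (ha : 0 ≤ a) (hab : a ≤ b) :
    t ^ a ≤ 1 + t ^ b := by
  rcases le_total t 1 with h | h
  · exact (Real.rpow_le_one ht h ha).trans (le_add_of_nonneg_right (by positivity))
  · exact (Real.rpow_le_rpow_of_exponent_le h hab).trans (le_add_of_nonneg_left zero_le_one)

lemma integrableOn_rpow_of_integrableOn_rpow {u : EuclideanSpace ℝ (Fin n) → ℝ}
    {s : Set (EuclideanSpace ℝ (Fin n))} (hs : MeasurableSet s) (hsv : volume s ≠ ⊤)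
    (hu : ContinuousOn u s) (hu0 : ∀ x ∈ s, 0 ≤ u x) {a b : ℝ} (ha : 0 ≤ a) (hab : a ≤ b)
    (hi : IntegrableOn (fun x => u x ^ b) s) : IntegrableOn (fun x => u x ^ a) s := by
  have h1 : IntegrableOn (fun x => 1 + u x ^ b) s :=
    (integrableOn_const (C := (1 : ℝ)) hsv).add hi
  refine h1.mono' ?_ ?_
  · exact (hu.rpow_const fun x _ => Or.inr ha).aestronglyMeasurable hs
  · filter_upwards [ae_restrict_mem hs] with x hx
    rw [Real.norm_of_nonneg (Real.rpow_nonneg (hu0 x hx) _)]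
    exact rpow_le_one_add_rpow (hu0 x hx) ha hab

lemma indicator_rpow {u : EuclideanSpace ℝ (Fin n) → ℝ} {s : Set (EuclideanSpace ℝ (Fin n))}
    {a : ℝ} (ha : a ≠ 0) (x : EuclideanSpace ℝ (Fin n)) :
    s.indicator u x ^ a = s.indicator (fun y => u y ^ a) x := by
  by_cases hx : x ∈ s
  · rw [Set.indicator_of_mem hx, Set.indicator_of_mem hx]
  · rw [Set.indicator_of_notMem hx, Set.indicator_of_notMem hx, Real.zero_rpow ha]

/-- A solution on the punctured ball which is `C⁴` up to the origin extends across it. -/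
lemma exists_extension_of_contDiff (hn : n ≠ 0) {p : ℝ} (hp : 0 < p)
    {u W : EuclideanSpace ℝ (Fin n) → ℝ} (hreg : ContDiffOn ℝ 4 u (ball 0 1 \ {0}))
    (heq : ∀ x ∈ ball (0 : EuclideanSpace ℝ (Fin n)) 1 \ {0}, bilap u x = u x ^ p)
    (hW : ContDiff ℝ 4 W) {r : ℝ} (hr : 0 < r) (huW : ∀ x, x ≠ 0 → ‖x‖ < r → u x = W x) :
    ∃ v : EuclideanSpace ℝ (Fin n) → ℝ, ContDiffOn ℝ 4 v (ball 0 1) ∧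
      (∀ x ∈ ball (0 : EuclideanSpace ℝ (Fin n)) 1, bilap v x = v x ^ p) ∧
      (∀ x ∈ ball (0 : EuclideanSpace ℝ (Fin n)) 1 \ {0}, v x = u x) := by
  have hopen : IsOpen (ball (0 : EuclideanSpace ℝ (Fin n)) 1 \ {0}) :=
    isOpen_ball.sdiff isClosed_singleton
  set v := Function.update u 0 (W 0) with hv
  have hvu (x) (hx : x ≠ 0) : v =ᶠ[𝓝 x] u := by
    filter_upwards [isOpen_ne.mem_nhds hx] with y hy
    exact Function.update_of_ne hy _ _
  have hvW : v =ᶠ[𝓝 0] W := by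
    filter_upwards [ball_mem_nhds 0 hr] with y hy
    rcases eq_or_ne y 0 with rfl | hy0
    · exact Function.update_self _ _ _
    · rw [hv, Function.update_of_ne hy0, huW y hy0 (by simpa using hy)]
  have heq' (x) (hx : x ∈ ball (0 : EuclideanSpace ℝ (Fin n)) 1 \ {0}) :
      bilap v x = v x ^ p := by
    rw [(bilap_congr (hvu x hx.2)).eq_of_nhds, heq x hx, (hvu x hx.2).eq_of_nhds]
  refine ⟨v, fun x hx => ?_, fun x hx => ?_, fun x hx => (hvu x hx.2).eq_of_nhds⟩
  · rcases eq_or_ne x 0 with rfl | hx0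
    · exact (hW.contDiffAt.congr_of_eventuallyEq hvW).contDiffWithinAt
    · exact ((hreg.contDiffAt (hopen.mem_nhds ⟨hx, hx0⟩)).congr_of_eventuallyEq
        (hvu x hx0)).contDiffWithinAt
  · rcases eq_or_ne x 0 with rfl | hx0
    · have : NeZero n := ⟨hn⟩
      have hv4 : ContDiffAt ℝ 4 v 0 := hW.contDiffAt.congr_of_eventuallyEq hvW
      have h1 : ContinuousAt (bilap v) 0 :=
        (contDiffAt_bilap (k := 0) (m := 4) hv4 (by norm_num)).continuousAt
      have h2 : ContinuousAt (fun x => v x ^ p) 0 := hv4.continuousAt.rpow_const (Or.inr hp.le)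
      refine tendsto_nhds_unique_of_eventuallyEq (l := 𝓝[≠] 0)
        (h1.mono_left nhdsWithin_le_nhds) (h2.mono_left nhdsWithin_le_nhds) ?_
      filter_upwards [self_mem_nhdsWithin, nhdsWithin_le_nhds (ball_mem_nhds 0 one_pos)]
        with y hy0 hy
      exact heq' y ⟨hy, hy0⟩
    · exact heq' x ⟨hx, hx0⟩

end Removability

/-- Removable singularity: if `∫_{0<|x|≤1/2} u^{(p-1)n/4} < ∞`, then `u`
extends to a `C⁴` solution of `Δ²u = u^p` in the entire unit ball. -/
theorem stmt_13 (n : ℕ) (hn : 5 ≤ n) (p : ℝ)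
    (hp1 : (n : ℝ) / ((n : ℝ) - 4) < p) (hp2 : p < ((n : ℝ) + 4) / ((n : ℝ) - 4))
    (u : EuclideanSpace ℝ (Fin n) → ℝ)
    (hreg : ContDiffOn ℝ 4 u (ball 0 1 \ {0}))
    (hpos : ∀ x ∈ ball (0 : EuclideanSpace ℝ (Fin n)) 1 \ {0}, 0 ≤ u x)
    (heq : ∀ x ∈ ball (0 : EuclideanSpace ℝ (Fin n)) 1 \ {0}, bilap u x = u x ^ p)
    (hint : IntegrableOn (fun x => u x ^ ((p - 1) * (n : ℝ) / 4))
      (closedBall (0 : EuclideanSpace ℝ (Fin n)) (1 / 2) \ {0}) volume) :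
    ∃ v : EuclideanSpace ℝ (Fin n) → ℝ,
      ContDiffOn ℝ 4 v (ball 0 1) ∧
      (∀ x ∈ ball (0 : EuclideanSpace ℝ (Fin n)) 1, bilap v x = v x ^ p) ∧
      (∀ x ∈ ball (0 : EuclideanSpace ℝ (Fin n)) 1 \ {0}, v x = u x) := by
  have hn' : (5 : ℝ) ≤ n := by exact_mod_cast hn
  have hn4 : (0 : ℝ) < n - 4 := by linarith
  have hp1' : (n : ℝ) < p * (n - 4) := (div_lt_iff₀ hn4).1 hp1
  have hp : 1 < p := by
    by_contra! hle
    have : p * (n - 4) ≤ 1 * (n - 4) := mul_le_mul_of_nonneg_right hle hn4.le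
    linarith
  have hp0 : 0 < p - 1 := by linarith
  set q := (p - 1) * (n : ℝ) / 4 with hq
  set α := 4 / (p - 1) with hα
  have hα0 : 0 < α := by positivity
  have hα4 : α < n - 4 := by
    rw [hα, div_lt_iff₀ hp0]
    linarith
  have hαq : α * q = n := by rw [hα, hq]; field_simp
  have hαp : α * p = α + 4 := by rw [hα]; field_simp; ring
  have hpq : p ≤ q := by
    by_contra! hlt
    have := mul_lt_mul_of_pos_left hlt hα0
    linarith
  have hq1 : 1 < q := hp.trans_le hpq
  set s := closedBall (0 : EuclideanSpace ℝ (Fin n)) (1 / 2) \ {0} with hs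
  have hss : s ⊆ ball 0 1 \ {0} :=
    Set.sdiff_subset_sdiff_left (closedBall_subset_ball (by norm_num))
  have hsm : MeasurableSet s := measurableSet_closedBall.diff (measurableSet_singleton 0)
  have hsv : volume s ≠ ⊤ :=
    ((measure_mono Set.sdiff_subset).trans_lt measure_closedBall_lt_top).ne
  have hus : ContinuousOn u s := hreg.continuousOn.mono hss
  have hus0 : ∀ x ∈ s, 0 ≤ u x := fun x hx => hpos x (hss hx)
  have hint' (a : ℝ) (ha : 0 < a) (haq : a ≤ q) :
      Integrable fun x => s.indicator u x ^ a := by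
    simp_rw [indicator_rpow ha.ne']
    exact (integrableOn_rpow_of_integrableOn_rpow hsm hsv hus hus0 ha.le haq
      hint).integrable_indicator hsm
  set U := s.indicator u with hU
  have hU0 : U 0 = 0 := Set.indicator_of_notMem (by simp [hs]) _
  have hUnn (y) : 0 ≤ U y := Set.indicator_nonneg hus0 y
  have hUu (y : EuclideanSpace ℝ (Fin n)) (hy : y ≠ 0) (hy2 : ‖y‖ < 1 / 2) : U =ᶠ[𝓝 y] u := by
    filter_upwards [isOpen_ne.mem_nhds hy, isOpen_ball.mem_nhds (mem_ball_zero_iff.2 hy2)]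
      with z hz hz2
    exact Set.indicator_of_mem (s := s) ⟨ball_subset_closedBall hz2, hz⟩ _
  have hmem (y : EuclideanSpace ℝ (Fin n)) (hy : y ≠ 0) (hy2 : ‖y‖ < 1 / 2) :
      y ∈ ball (0 : EuclideanSpace ℝ (Fin n)) 1 \ {0} :=
    ⟨mem_ball_zero_iff.2 (by linarith), hy⟩
  have hUd (y) (hy : y ≠ 0) (hy2 : ‖y‖ < 1 / 2) : ContDiffAt ℝ 4 U y :=
    (hreg.contDiffAt ((isOpen_ball.sdiff isClosed_singleton).mem_nhds
      (hmem y hy hy2))).congr_of_eventuallyEq (hUu y hy hy2)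
  have hUi : Integrable U := by simpa using hint' 1 one_pos hq1.le
  have hfi : Integrable fun y => U y ^ p := hint' p (by linarith) hpq
  have hUq : Integrable fun y => U y ^ q := hint' q (by linarith) le_rfl
  have hfnn (y) : 0 ≤ U y ^ p := Real.rpow_nonneg (hUnn y) _
  have hsol : IsWeakSol U fun y => U y ^ p :=
    { integrable := hUi
      integrable_rhs := hfi
      nonneg := hUnn
      nonneg_rhs := hfnn
      continuousAt := fun y hy hy2 => (hUd y hy hy2).continuousAt
      continuousAt_rhs := fun y hy hy2 =>
        (hUd y hy hy2).continuousAt.rpow_const (Or.inr (by linarith))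
      weak := fun φ hφ hsupp => weak_of_punctured hq1 hαq hα4 (by omega) hUnn hUi hUq hfnn hfi hUd
        (fun y hy hy2 => by
          rw [(bilap_congr (hUu y hy hy2)).eq_of_nhds, heq y (hmem y hy hy2),
            (hUu y hy hy2).eq_of_nhds]) hφ hsupp }
  obtain ⟨r, hr, hr4, M, -, hM⟩ := hsol.exists_bound hn hp hq1 hα0 hα4 hαp hαq (fun _ => rfl) hU0 hUq
  obtain ⟨W, hW, r', hr', hUW⟩ := hsol.exists_contDiff_four hn hp (fun _ => rfl) hr hr4 hM
  refine exists_extension_of_contDiff (by omega) (by linarith) hreg heq hW (r := min r' (1 / 2))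
    (by positivity) fun x hx hxr => ?_
  rw [← hUW x hx (hxr.trans_le (min_le_left _ _)),
    (hUu x hx (hxr.trans_le (min_le_right _ _))).eq_of_nhds]
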